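/- Let T⁺ ⊆ S¹ × S¹ × S¹ denote the subspace of positively oriented triples. The map Φ : T⁺ → flags defined by Φ(x,y,z) = (ℙ(ξ²(y) ∩ ξ²(z)), (ξ²(y) ∩ ξ²(z)) + x¹) is well defined (the subspace ξ²(y) ∩ ξ²(z) is 1-dimensional, the sum (ξ²(y) ∩ ξ²(z)) + x¹ is 2-dimensional, and the resulting flag lies in Ω²), its image is exactly Ω², and Φ is a two-sheeted covering map onto Ω². -/

import Mathlib

noncomputable section

open Filter Topology Module
open scoped LinearAlgebra.Projectivization

namespace CFF

instance {K V : Type*} [DivisionRing K] [AddCommGroup V] [Module K V] [TopologicalSpace V] :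
    TopologicalSpace (ℙ K V) :=
  inferInstanceAs (TopologicalSpace (Quotient (projectivizationSetoid K V)))

instance : TopologicalSpace (Module.Dual ℝ (Fin 3 → ℝ)) :=
  TopologicalSpace.induced (LinearEquiv.piRing ℝ ℝ (Fin 3) ℝ) inferInstance

/-- The projective line in `ℙ(ℝ³)` determined by a plane `W ≤ ℝ³`. -/
def projLine (W : Submodule ℝ (Fin 3 → ℝ)) : Set (ℙ ℝ (Fin 3 → ℝ)) :=
  {p | p.submodule ≤ W}

/-- `C ⊆ ℙ(ℝ³)` is properly convex: there is a linear functional `f` nonzero on every nonzero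
vector spanning a point of the closure of `C`, such that the image of `C` in the affine chart
`{[v] : f v = 1}` is convex. -/
def ProperlyConvex (C : Set (ℙ ℝ (Fin 3 → ℝ))) : Prop :=
  ∃ f : (Fin 3 → ℝ) →ₗ[ℝ] ℝ,
    (∀ (v : Fin 3 → ℝ) (hv : v ≠ 0), Projectivization.mk ℝ v hv ∈ closure C → f v ≠ 0) ∧
    Convex ℝ {w : Fin 3 → ℝ | f w = 1 ∧ ∃ hw : w ≠ 0, Projectivization.mk ℝ w hw ∈ C}

/-- The frontier of `C` contains no three distinct collinear points. -/
def StrictlyConvexBoundary (C : Set (ℙ ℝ (Fin 3 → ℝ))) : Prop :=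
  ∀ p q r : ℙ ℝ (Fin 3 → ℝ), p ∈ frontier C → q ∈ frontier C → r ∈ frontier C →
    p ≠ q → p ≠ r → q ≠ r →
    ∀ W : Submodule ℝ (Fin 3 → ℝ), finrank ℝ W = 2 →
      ¬ (p.submodule ≤ W ∧ q.submodule ≤ W ∧ r.submodule ≤ W)

/-- `W` determines a supporting line of `C` at the frontier point `p`: a projective line
containing `p` and disjoint from `C`. -/
def IsSupportingLineAt (C : Set (ℙ ℝ (Fin 3 → ℝ))) (W : Submodule ℝ (Fin 3 → ℝ))
    (p : ℙ ℝ (Fin 3 → ℝ)) : Prop :=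
  finrank ℝ W = 2 ∧ p ∈ frontier C ∧ p.submodule ≤ W ∧ projLine W ∩ C = ∅

/-- `(x, y, z)` is a positively oriented triple on the circle: `y` and `z` occur in that order
when traversing the circle counterclockwise starting from `x`.  (This implies the three points
are pairwise distinct.) -/
def PosOriented (x y z : Circle) : Prop :=
  ∃ a b c : ℝ, Circle.exp a = x ∧ Circle.exp b = y ∧ Circle.exp c = z ∧
    a < b ∧ b < c ∧ c < a + 2 * Real.pi

/-- The space of flags `(p, l)`, realized inside `ℙ(ℝ³) × ℙ((ℝ³)*)`: the pair `(p, φ)`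
represents the flag whose line is the plane annihilated by `φ`, and `p` must lie on it. -/
def Flags : Set (ℙ ℝ (Fin 3 → ℝ) × ℙ ℝ (Module.Dual ℝ (Fin 3 → ℝ))) :=
  {pl | pl.1.submodule ≤ pl.2.submodule.dualCoannihilator}

/-- The flags `(p, l)` with `p` outside the closure of `C` and `ℙ(l)` meeting `C`. -/
def Omega2 (C : Set (ℙ ℝ (Fin 3 → ℝ))) :
    Set (ℙ ℝ (Fin 3 → ℝ) × ℙ ℝ (Module.Dual ℝ (Fin 3 → ℝ))) :=
  {pl | pl ∈ Flags ∧ pl.1 ∉ closure C ∧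
    ∃ q ∈ C, q.submodule ≤ pl.2.submodule.dualCoannihilator}


section Aux

open Matrix

theorem cover_aux {E X : Type*} [TopologicalSpace E] [TopologicalSpace X] [T2Space E]
    (f : E → X) (hc : Continuous f) (ho : IsOpenMap f)
    (hinj : ∀ e, ∃ U ∈ 𝓝 e, Set.InjOn f U) (hcard : ∀ b, (f ⁻¹' {b}).ncard = 2) :
    IsCoveringMap f := by
  intro x
  obtain ⟨e₁, e₂, hne, hfib⟩ := Set.ncard_eq_two.1 (hcard x)
  have h1 : f e₁ = x := by
    have : e₁ ∈ f ⁻¹' {x} := by rw [hfib]; simp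
    exact this
  have h2 : f e₂ = x := by
    have : e₂ ∈ f ⁻¹' {x} := by rw [hfib]; simp
    exact this
  obtain ⟨A₁, A₂, hA₁, hA₂, m₁, m₂, hdis⟩ := t2_separation hne
  obtain ⟨B₁, hB₁, i₁⟩ := hinj e₁
  obtain ⟨B₂, hB₂, i₂⟩ := hinj e₂
  obtain ⟨V₁, hV₁, oV₁, mV₁⟩ := mem_nhds_iff.1 (inter_mem (hA₁.mem_nhds m₁) hB₁)
  obtain ⟨V₂, hV₂, oV₂, mV₂⟩ := mem_nhds_iff.1 (inter_mem (hA₂.mem_nhds m₂) hB₂)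
  have hd : Disjoint V₁ V₂ :=
    hdis.mono (hV₁.trans Set.inter_subset_left) (hV₂.trans Set.inter_subset_left)
  have j₁ : Set.InjOn f V₁ := i₁.mono (hV₁.trans Set.inter_subset_right)
  have j₂ : Set.InjOn f V₂ := i₂.mono (hV₂.trans Set.inter_subset_right)
  set U : Set X := f '' V₁ ∩ f '' V₂ with hU
  have oU : IsOpen U := (ho _ oV₁).inter (ho _ oV₂)
  have xU : x ∈ U := ⟨⟨e₁, mV₁, h1⟩, ⟨e₂, mV₂, h2⟩⟩
  let V : Bool → Set E := fun b => if b then V₁ else V₂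
  have oV : ∀ b, IsOpen (V b) := by rintro (_ | _) <;> simp [V, oV₁, oV₂]
  have jV : ∀ b, Set.InjOn f (V b) := by rintro (_ | _) <;> simp [V, j₁, j₂]
  have sV : ∀ b, Set.SurjOn f (V b) U := by
    rintro (_ | _) y ⟨hy1, hy2⟩
    · simpa [V] using hy2
    · simpa [V] using hy1
  have : Nonempty (X → E) := ⟨fun _ => e₁⟩
  refine (IsEvenlyCovered.of_trivialization (I := Bool) (t := IsOpen.trivializationDiscrete V U oU
    ?_ jV sV ?_ ?_) xU).to_isEvenlyCovered_preimage
  · intro b s hs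
    constructor
    · intro h
      exact (h.preimage hc).inter (oV b)
    · intro h
      have := ho _ h
      convert this using 1
      ext y
      constructor
      · intro hy
        obtain ⟨e, he, rfl⟩ := sV b (hs hy)
        exact ⟨e, ⟨hy, he⟩, rfl⟩
      · rintro ⟨e, he, rfl⟩
        exact he.1
  · rintro (_ | _) (_ | _) h <;> simp_all [V, Function.onFun, disjoint_comm]
  · rintro e ⟨⟨a, ha, hae⟩, ⟨b, hb, hbe⟩⟩
    obtain ⟨c, d, hcd, hf⟩ := Set.ncard_eq_two.1 (hcard (f e))
    have ha' : a ∈ f ⁻¹' {f e} := hae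
    have hb' : b ∈ f ⁻¹' {f e} := hbe
    have he' : e ∈ f ⁻¹' {f e} := rfl
    have hab : a ≠ b := fun h => Set.disjoint_left.1 hd ha (h ▸ hb)
    rw [hf] at ha' hb' he'
    simp only [Set.mem_insert_iff, Set.mem_singleton_iff] at ha' hb' he'
    have : e = a ∨ e = b := by grind
    rcases this with rfl | rfl
    · exact Set.mem_iUnion.2 ⟨true, by simpa [V] using ha⟩
    · exact Set.mem_iUnion.2 ⟨false, by simpa [V] using hb⟩

theorem exists_lift (a : ℝ) (y : Circle) (h : Circle.exp a ≠ y) :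
    ∃ b, Circle.exp b = y ∧ a < b ∧ b < a + 2 * Real.pi := by
  obtain ⟨b, rfl⟩ := Circle.exp_surjective y
  have hp := Real.two_pi_pos
  have e : toIcoMod hp a b = b - toIcoDiv hp a b • (2 * Real.pi) := rfl
  rw [zsmul_eq_mul] at e
  have e2 : Circle.exp (toIcoMod hp a b) = Circle.exp b := by
    rw [Circle.exp_eq_exp]
    refine ⟨-toIcoDiv hp a b, ?_⟩
    rw [e]; push_cast; ring
  refine ⟨toIcoMod hp a b, e2, ?_, toIcoMod_lt_right hp a b⟩
  refine lt_of_le_of_ne (left_le_toIcoMod hp a b) ?_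
  intro h'
  apply h
  rw [← e2, ← h']

theorem pos_total {x y z : Circle} (hxy : x ≠ y) (hxz : x ≠ z) (hyz : y ≠ z) :
    PosOriented x y z ∨ PosOriented x z y := by
  obtain ⟨a, rfl⟩ := Circle.exp_surjective x
  obtain ⟨b, rfl, h1, h2⟩ := exists_lift a y hxy
  obtain ⟨c, rfl, h3, h4⟩ := exists_lift a z hxz
  rcases lt_trichotomy b c with h | h | h
  · exact Or.inl ⟨a, b, c, rfl, rfl, rfl, h1, h, h4⟩
  · exact absurd (by rw [h]) hyz
  · exact Or.inr ⟨a, c, b, rfl, rfl, rfl, h3, h, h2⟩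

theorem lift_unique {a a' b b' : ℝ} (ha : Circle.exp a = Circle.exp a')
    (hb : Circle.exp b = Circle.exp b') (h1 : a < b) (h2 : b < a + 2 * Real.pi)
    (h1' : a' < b') (h2' : b' < a' + 2 * Real.pi) : b - a = b' - a' := by
  obtain ⟨m, hm⟩ := Circle.exp_eq_exp.1 ha
  obtain ⟨n, hn⟩ := Circle.exp_eq_exp.1 hb
  have hp := Real.two_pi_pos
  have e : b - a = b' - a' + ((n - m : ℤ) : ℝ) * (2 * Real.pi) := by
    rw [hm, hn]; push_cast; ring
  have l1 : ((n - m : ℤ) : ℝ) < 1 := by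
    by_contra h
    push Not at h
    nlinarith
  have l2 : (-1 : ℝ) < ((n - m : ℤ) : ℝ) := by
    by_contra h
    push Not at h
    nlinarith
  have : n - m = 0 := by
    have l1' : n - m < 1 := by exact_mod_cast l1
    have l2' : -1 < n - m := by exact_mod_cast l2
    omega
  rw [e, this]; simp

theorem pos_asymm {x y z : Circle} (h : PosOriented x y z) (h' : PosOriented x z y) : False := by
  obtain ⟨a, b, c, rfl, rfl, rfl, h1, h2, h3⟩ := h
  obtain ⟨a', c', b', ha, hc, hb, h1', h2', h3'⟩ := h'
  have := lift_unique ha hb (by linarith) (by linarith) (by linarith) (by linarith)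
  have := lift_unique ha hc (by linarith) (by linarith) (by linarith) (by linarith)
  linarith

theorem exp_ne {a b : ℝ} (h1 : a < b) (h2 : b < a + 2 * Real.pi) : Circle.exp a ≠ Circle.exp b := by
  intro h
  obtain ⟨m, hm⟩ := Circle.exp_eq_exp.1 h
  have hp := Real.two_pi_pos
  have l1 : (m : ℝ) < 0 := by
    by_contra h
    push Not at h
    nlinarith
  have l2 : (-1 : ℝ) < m := by
    by_contra h
    push Not at h
    nlinarith
  have l1' : m < 0 := by exact_mod_cast l1
  have l2' : -1 < m := by exact_mod_cast l2
  omega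

theorem pos_ne {x y z : Circle} (h : PosOriented x y z) : x ≠ y ∧ x ≠ z ∧ y ≠ z := by
  obtain ⟨a, b, c, rfl, rfl, rfl, h1, h2, h3⟩ := h
  exact ⟨exp_ne (by linarith) (by linarith), exp_ne (by linarith) (by linarith),
    exp_ne (by linarith) (by linarith)⟩

theorem pos_open : IsOpen {t : Circle × Circle × Circle | PosOriented t.1 t.2.1 t.2.2} := by
  have ho : IsOpenMap (Prod.map Circle.exp (Prod.map Circle.exp Circle.exp)) :=
    isLocalHomeomorph_circleExp.isOpenMap.prodMap
      (isLocalHomeomorph_circleExp.isOpenMap.prodMap isLocalHomeomorph_circleExp.isOpenMap)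
  have hs : IsOpen {s : ℝ × ℝ × ℝ | s.1 < s.2.1 ∧ s.2.1 < s.2.2 ∧ s.2.2 < s.1 + 2 * Real.pi} := by
    refine IsOpen.and ?_ (IsOpen.and ?_ ?_) <;> exact isOpen_lt (by fun_prop) (by fun_prop)
  convert ho _ hs using 1
  ext ⟨x, y, z⟩
  constructor
  · rintro ⟨a, b, c, rfl, rfl, rfl, h⟩
    exact ⟨(a, b, c), h, rfl⟩
  · rintro ⟨⟨a, b, c⟩, h, he⟩
    simp only [Prod.map_apply, Prod.mk.injEq] at he
    exact ⟨a, b, c, he.1, he.2.1, he.2.2, h⟩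

/-- two zeros from a sign change on the circle -/
theorem two_zeros (g : Circle → ℝ) (hg : Continuous g) {x y : Circle} (hx : g x < 0)
    (hy : 0 < g y) : ∃ a b, a ≠ b ∧ g a = 0 ∧ g b = 0 := by
  have hxy : x ≠ y := by rintro rfl; linarith
  obtain ⟨s, rfl⟩ := Circle.exp_surjective x
  obtain ⟨t, rfl, h1, h2⟩ := exists_lift s y hxy
  have hc : Continuous (fun r => g (Circle.exp r)) := by fun_prop
  obtain ⟨a, ha, ha0⟩ := intermediate_value_Ioo h1.le hc.continuousOn (show (0 : ℝ) ∈ _ from ⟨hx, hy⟩)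
  have hx' : g (Circle.exp (s + 2 * Real.pi)) < 0 := by
    rwa [Circle.exp_add_two_pi]
  obtain ⟨b, hb, hb0⟩ := intermediate_value_Ioo' h2.le hc.continuousOn
    (show (0 : ℝ) ∈ _ from ⟨hx', hy⟩)
  exact ⟨_, _, exp_ne (ha.2.trans hb.1) (by linarith [ha.1, hb.2]), ha0, hb0⟩

theorem perturb {P : Type*} [TopologicalSpace P] (g : P → Circle → ℝ)
    (h1 : ∀ p, Continuous (g p)) (h2 : ∀ x, Continuous fun p => g p x) (p₀ : P) (x₀ : Circle)
    (hneg : ∀ U ∈ 𝓝 x₀, ∃ x ∈ U, g p₀ x < 0) (hpos : ∀ U ∈ 𝓝 x₀, ∃ x ∈ U, 0 < g p₀ x)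
    (U : Set Circle) (hU : U ∈ 𝓝 x₀) : ∀ᶠ p in 𝓝 p₀, ∃ x ∈ U, g p x = 0 := by
  obtain ⟨θ, rfl⟩ := Circle.exp_surjective x₀
  obtain ⟨ε, hε, hb⟩ := Metric.mem_nhds_iff.1 (Circle.exp.continuous.continuousAt.preimage_mem_nhds hU)
  set W : Set Circle := Circle.exp '' Metric.ball θ ε with hW
  have hWn : W ∈ 𝓝 (Circle.exp θ) :=
    isLocalHomeomorph_circleExp.isOpenMap.image_mem_nhds (Metric.ball_mem_nhds θ hε)
  have hWU : W ⊆ U := by rintro _ ⟨t, ht, rfl⟩; exact hb ht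
  have hWc : IsPreconnected W :=
    ((convex_ball θ ε).isPreconnected).image _ Circle.exp.continuous.continuousOn
  obtain ⟨a, ha, ha0⟩ := hneg W hWn
  obtain ⟨b, hb, hb0⟩ := hpos W hWn
  filter_upwards [(h2 a).continuousAt.eventually (gt_mem_nhds ha0),
    (h2 b).continuousAt.eventually (lt_mem_nhds hb0)] with p hp1 hp2
  obtain ⟨x, hx, hx0⟩ := hWc.intermediate_value ha hb (h1 p).continuousOn ⟨hp1.le, hp2.le⟩
  exact ⟨x, hWU hx, hx0⟩

abbrev Vec := Fin 3 → ℝ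

theorem cont_dot : Continuous fun q : Vec × Vec => q.1 ⬝ᵥ q.2 := by
  simp only [dotProduct]; fun_prop

theorem cont_cross : Continuous fun q : Vec × Vec => q.1 ⨯₃ q.2 := by
  simp only [cross_apply]
  refine continuous_pi fun i => ?_
  fin_cases i <;> simp <;> fun_prop

theorem parallel_cross {a b u : Vec} (h : a ⨯₃ b ≠ 0) (ha : u ⬝ᵥ a = 0) (hb : u ⬝ᵥ b = 0) :
    ∃ t : ℝ, u = t • (a ⨯₃ b) := by
  set n := a ⨯₃ b with hn
  have hnn : n ⬝ᵥ n ≠ 0 := by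
    intro h0; exact h (dotProduct_self_eq_zero.1 h0)
  refine ⟨(n ⬝ᵥ u) / (n ⬝ᵥ n), ?_⟩
  have h1 : u ⨯₃ n = 0 := by
    rw [hn, cross_cross_eq_smul_sub_smul']
    rw [dotProduct_comm] at ha
    simp [ha, hb]
  have h2 : n ⨯₃ (u ⨯₃ n) = (n ⬝ᵥ n) • u - (n ⬝ᵥ u) • n := by
    rw [cross_cross_eq_smul_sub_smul']
    rw [dotProduct_comm u n]
  rw [h1] at h2
  simp at h2
  rw [div_eq_inv_mul, mul_smul, ← sub_eq_zero.1 h2.symm, smul_smul, inv_mul_cancel₀ hnn, one_smul]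

theorem cramer3 (a b c u : Vec) : (c ⬝ᵥ a ⨯₃ b) • u =
    (u ⬝ᵥ b ⨯₃ c) • a + (u ⬝ᵥ c ⨯₃ a) • b + (u ⬝ᵥ a ⨯₃ b) • c := by
  ext i
  fin_cases i <;> simp [cross_apply, dotProduct, Fin.sum_univ_three] <;> ring

theorem exit_aux {X : Type*} [TopologicalSpace X] {D S : Set X} (hD : IsOpen D)
    (hS : IsPreconnected S) {a b : X} (ha : a ∈ S) (hb : b ∈ S) (haD : a ∈ D)
    (hbD : b ∉ closure D) : ∃ u ∈ S, u ∈ closure D ∧ u ∉ D := by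
  by_contra hcon
  push Not at hcon
  obtain ⟨u, -, hu1, hu2⟩ := hS D (closure D)ᶜ hD isClosed_closure.isOpen_compl
    (fun x hx => by
      by_cases h : x ∈ closure D
      · exact Or.inl (hcon x hx h)
      · exact Or.inr h) ⟨a, ha, haD⟩ ⟨b, hb, hbD⟩
  exact hu2 (subset_closure hu1)

structure CD where
  D : Set Vec
  f : Vec →ₗ[ℝ] ℝ
  v : Circle → Vec
  φ : Circle → Vec
  hDo : IsOpen D
  hDc : Convex ℝ D
  hDs : ∀ d ∈ D, ∀ t : ℝ, 0 < t → t • d ∈ D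
  hDne : D.Nonempty
  hv : Continuous v
  hφ : Continuous φ
  fv : ∀ x, f (v x) = 1
  vcl : ∀ x, v x ∈ closure D
  vnot : ∀ x, v x ∉ D
  vinj : Function.Injective v
  vsurj : ∀ u ∈ closure D, u ∉ D → u ≠ 0 → 0 < f u ∧ ∃ x, u = f u • v x
  φv : ∀ x, φ x ⬝ᵥ v x = 0
  φD : ∀ x, ∀ d ∈ D, 0 < φ x ⬝ᵥ d
  φpos : ∀ x y, x ≠ y → 0 < φ x ⬝ᵥ v y
  three : ∀ ψ : Vec, ψ ≠ 0 → ∀ a b c, ψ ⬝ᵥ v a = 0 → ψ ⬝ᵥ v b = 0 → ψ ⬝ᵥ v c = 0 →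
    a ≠ b → a ≠ c → b ≠ c → False
  uniq : ∀ ψ : Vec, ψ ≠ 0 → ∀ x, ψ ⬝ᵥ v x = 0 → (∀ d ∈ D, ψ ⬝ᵥ d ≠ 0) → ∃ t : ℝ, φ x = t • ψ

namespace CD

variable (S : CD)

def Out (p : Vec) : Prop := p ≠ 0 ∧ p ∉ closure S.D ∧ -p ∉ closure S.D

variable {S}

theorem Out.neg {p : Vec} (h : S.Out p) : S.Out (-p) :=
  ⟨neg_ne_zero.2 h.1, h.2.2, by simpa using h.2.1⟩

theorem Out.ne_smul {p c : Vec} (h : S.Out p) (hc : c ∈ S.D) (k : ℝ) : p ≠ k • c := by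
  rintro rfl
  rcases lt_trichotomy k 0 with hk | rfl | hk
  · apply h.2.2
    have := S.hDs c hc (-k) (by linarith)
    rw [← neg_smul]; exact subset_closure this
  · exact h.1 (by simp)
  · exact h.2.1 (subset_closure (S.hDs c hc k hk))

theorem exit {p c : Vec} (h : S.Out p) (hc : c ∈ S.D) :
    ∃ x, ∃ a b : ℝ, 0 < a ∧ 0 < b ∧ S.v x = a • c + b • p := by
  obtain ⟨u, hu, hu1, hu2⟩ := exit_aux S.hDo (convex_segment (𝕜 := ℝ) c p).isPreconnected
    (left_mem_segment ℝ c p) (right_mem_segment ℝ c p) hc h.2.1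
  obtain ⟨a, b, ha, hb, hab, rfl⟩ := hu
  have ha' : 0 < a := by
    rcases ha.lt_or_eq with h0 | rfl
    · exact h0
    · exfalso; apply h.2.1
      have : b = 1 := by linarith
      simpa [this] using hu1
  have hb' : 0 < b := by
    rcases hb.lt_or_eq with h0 | rfl
    · exact h0
    · exfalso; apply hu2
      have : a = 1 := by linarith
      simpa [this] using hc
  have hne : a • c + b • p ≠ 0 := by
    intro h0
    apply h.ne_smul hc (-(b⁻¹ * a))
    have : b • p = -(a • c) := by rw [eq_neg_iff_add_eq_zero, add_comm]; exact h0
    rw [neg_smul, mul_smul, ← smul_neg, ← this, smul_smul, inv_mul_cancel₀ hb'.ne', one_smul]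
  obtain ⟨hf, x, hx⟩ := S.vsurj _ hu1 hu2 hne
  set r := S.f (a • c + b • p)
  refine ⟨x, r⁻¹ * a, r⁻¹ * b, by positivity, by positivity, ?_⟩
  rw [mul_smul, mul_smul, ← smul_add, hx, smul_smul, inv_mul_cancel₀ hf.ne', one_smul]

theorem φne (x : Circle) : S.φ x ≠ 0 := by
  intro h
  obtain ⟨d, hd⟩ := S.hDne
  have := S.φD x d hd
  simp [h] at this

theorem cross_φ {y z : Circle} (h : y ≠ z) : S.φ y ⨯₃ S.φ z ≠ 0 := by
  rw [crossProduct_ne_zero_iff_linearIndependent, LinearIndependent.pair_iff]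
  intro s t hst
  have h1 : (s • S.φ y + t • S.φ z) ⬝ᵥ S.v y = 0 := by rw [hst]; simp
  have h2 : (s • S.φ y + t • S.φ z) ⬝ᵥ S.v z = 0 := by rw [hst]; simp
  rw [add_dotProduct, smul_dotProduct, smul_dotProduct, S.φv, smul_eq_mul, smul_eq_mul] at h1 h2
  have := S.φpos y z h
  have := S.φpos z y h.symm
  constructor
  · have : s * (S.φ y ⬝ᵥ S.v z) = 0 := by linarith
    rcases mul_eq_zero.1 this with h | h
    · exact h
    · linarith
  · have : t * (S.φ z ⬝ᵥ S.v y) = 0 := by linarith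
    rcases mul_eq_zero.1 this with h | h
    · exact h
    · linarith

/-- three tangents are not concurrent -/
theorem three_tan {p : Vec} (hp : p ≠ 0) {a b c : Circle} (ha : S.φ a ⬝ᵥ p = 0)
    (hb : S.φ b ⬝ᵥ p = 0) (hc : S.φ c ⬝ᵥ p = 0) (hab : a ≠ b) (hac : a ≠ c) (hbc : b ≠ c) :
    False := by
  obtain ⟨t, ht⟩ := parallel_cross (cross_φ (S := S) hab) (by rwa [dotProduct_comm] at ha)
    (by rwa [dotProduct_comm] at hb)
  have ht0 : t ≠ 0 := by rintro rfl; simp at ht; exact hp ht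
  have hd : S.φ c ⬝ᵥ S.φ a ⨯₃ S.φ b = 0 := by
    rw [ht, dotProduct_smul, smul_eq_mul] at hc
    exact (mul_eq_zero.1 hc).resolve_left ht0
  set n := S.φ a ⨯₃ S.φ b with hn
  have hκ : 0 < n ⬝ᵥ n := by
    refine lt_of_le_of_ne ?_ fun h0 => cross_φ (S := S) hab (dotProduct_self_eq_zero.1 h0.symm)
    simp only [dotProduct]
    exact Finset.sum_nonneg fun i _ => mul_self_nonneg _
  have h1 := cramer3 (S.φ a) (S.φ b) (S.φ c) n
  rw [hd, zero_smul] at h1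
  rw [← hn] at h1
  set α := n ⬝ᵥ S.φ b ⨯₃ S.φ c
  set β := n ⬝ᵥ S.φ c ⨯₃ S.φ a
  have key : ∀ w : Vec, 0 = α * (S.φ a ⬝ᵥ w) + β * (S.φ b ⬝ᵥ w) + (n ⬝ᵥ n) * (S.φ c ⬝ᵥ w) := by
    intro w
    have := congrArg (fun q => q ⬝ᵥ w) h1
    simpa [add_dotProduct, smul_dotProduct] using this
  have ka := key (S.v a)
  have kb := key (S.v b)
  have kc := key (S.v c)
  rw [S.φv] at ka kb kc
  have p1 := S.φpos a b hab
  have p2 := S.φpos b a hab.symm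
  have p3 := S.φpos a c hac
  have p4 := S.φpos c a hac.symm
  have p5 := S.φpos b c hbc
  have p6 := S.φpos c b hbc.symm
  have q1 := mul_pos hκ p4
  have q2 := mul_pos hκ p6
  have hβ : β < 0 := by
    by_contra h; push Not at h
    nlinarith [mul_nonneg h p2.le]
  have hα : α < 0 := by
    by_contra h; push Not at h
    nlinarith [mul_nonneg h p1.le]
  nlinarith [mul_pos_of_neg_of_neg hα (neg_lt_zero.2 p3), mul_pos_of_neg_of_neg hβ (neg_lt_zero.2 p5)]

theorem contφdot (p : Vec) : Continuous fun y => S.φ y ⬝ᵥ p :=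
  cont_dot.comp (S.hφ.prodMk continuous_const)

theorem contvdot (p : Vec) : Continuous fun y => p ⬝ᵥ S.v y :=
  cont_dot.comp (continuous_const.prodMk S.hv)

theorem two_tan {p : Vec} (hp : S.Out p) :
    ∃ y z, y ≠ z ∧ ∀ w, S.φ w ⬝ᵥ p = 0 ↔ w = y ∨ w = z := by
  obtain ⟨o, ho⟩ := S.hDne
  obtain ⟨x₁, a, b, ha, hb, h1⟩ := exit hp ho
  obtain ⟨x₂, a', b', ha', hb', h2⟩ := exit hp.neg ho
  have e1 := S.φv x₁
  have e2 := S.φv x₂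
  rw [h1, dotProduct_add, dotProduct_smul, dotProduct_smul, smul_eq_mul, smul_eq_mul] at e1
  rw [h2, dotProduct_add, dotProduct_smul, dotProduct_smul, dotProduct_neg, smul_eq_mul,
    smul_eq_mul] at e2
  have g1 : S.φ x₁ ⬝ᵥ p < 0 := by
    have := mul_pos ha (S.φD x₁ o ho)
    by_contra h; push Not at h
    nlinarith [mul_nonneg hb.le h]
  have g2 : 0 < S.φ x₂ ⬝ᵥ p := by
    have := mul_pos ha' (S.φD x₂ o ho)
    by_contra h; push Not at h
    nlinarith [mul_nonneg hb'.le (neg_nonneg.2 h)]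
  obtain ⟨y, z, hyz, hy, hz⟩ := two_zeros _ (contφdot (S := S) p) g1 g2
  refine ⟨y, z, hyz, fun w => ⟨fun hw => ?_, ?_⟩⟩
  · by_contra hcon
    push Not at hcon
    exact three_tan hp.1 hw hy hz hcon.1 hcon.2 hyz
  · rintro (rfl | rfl) <;> assumption

theorem two_pts {p ψ c : Vec} (hp : S.Out p) (hψ : ψ ≠ 0) (hψp : ψ ⬝ᵥ p = 0) (hc : c ∈ S.D)
    (hψc : ψ ⬝ᵥ c = 0) : ∃ y z, y ≠ z ∧ ∀ w, ψ ⬝ᵥ S.v w = 0 ↔ w = y ∨ w = z := by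
  obtain ⟨x₁, a, b, ha, hb, h1⟩ := exit hp hc
  obtain ⟨x₂, a', b', ha', hb', h2⟩ := exit hp.neg hc
  have e1 : ψ ⬝ᵥ S.v x₁ = 0 := by rw [h1]; simp [hψp, hψc]
  have e2 : ψ ⬝ᵥ S.v x₂ = 0 := by rw [h2]; simp [hψp, hψc]
  have hne : x₁ ≠ x₂ := by
    rintro rfl
    rw [h1] at h2
    apply hp.ne_smul hc ((b + b')⁻¹ * (a' - a))
    have : (b + b') • p = (a' - a) • c := by
      rw [add_smul, sub_smul, eq_sub_iff_add_eq]
      calc b • p + b' • p + a • c = (a • c + b • p) + b' • p := by abel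
        _ = a' • c := by rw [h2]; simp
    rw [mul_smul, ← this, smul_smul, inv_mul_cancel₀ (by positivity), one_smul]
  refine ⟨x₁, x₂, hne, fun w => ⟨fun hw => ?_, ?_⟩⟩
  · by_contra hcon
    push Not at hcon
    exact S.three ψ hψ _ _ _ hw e1 e2 hcon.1 hcon.2 hne
  · rintro (rfl | rfl) <;> assumption

theorem signA {ψ c : Vec} {x₀ : Circle} (hψ : ψ ≠ 0) (hx : ψ ⬝ᵥ S.v x₀ = 0) (hc : c ∈ S.D)
    (hψc : ψ ⬝ᵥ c = 0) (U : Set Circle) (hU : U ∈ 𝓝 x₀) : ∃ x ∈ U, 0 < ψ ⬝ᵥ S.v x := by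
  have hemb := S.hv.isClosedEmbedding S.vinj
  rw [hemb.isInducing.nhds_eq_comap] at hU
  obtain ⟨N, hN, hNU⟩ := hU
  set v₀ := S.v x₀ with hv₀
  have hfc : Continuous S.f := LinearMap.continuous_of_finiteDimensional _
  have hO : ∀ᶠ w in 𝓝 v₀, 0 < S.f w ∧ (S.f w)⁻¹ • w ∈ N := by
    refine (hfc.continuousAt.eventually (lt_mem_nhds (by rw [S.fv]; norm_num))).and ?_
    have hcont : ContinuousAt (fun w => (S.f w)⁻¹ • w) v₀ :=
      (hfc.continuousAt.inv₀ (by rw [S.fv]; norm_num)).smul continuousAt_id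
    apply hcont.eventually_mem
    simpa [hv₀, S.fv] using hN
  obtain ⟨r, hr, hball⟩ := Metric.eventually_nhds_iff_ball.1 hO
  have hψψ : 0 < ψ ⬝ᵥ ψ := by
    refine lt_of_le_of_ne ?_ fun h0 => hψ (dotProduct_self_eq_zero.1 h0.symm)
    simp only [dotProduct]
    exact Finset.sum_nonneg fun i _ => mul_self_nonneg _
  -- choose δ
  have hδ1 : ∀ᶠ δ : ℝ in 𝓝[>] 0, v₀ + δ • (v₀ - c) ∈ Metric.ball v₀ r := by
    apply eventually_nhdsWithin_of_eventually_nhds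
    have : ContinuousAt (fun δ : ℝ => v₀ + δ • (v₀ - c)) 0 := by fun_prop
    apply this.eventually_mem
    simpa using Metric.ball_mem_nhds v₀ hr
  have hδ2 : ∀ᶠ δ : ℝ in 𝓝[>] 0, v₀ - δ • (v₀ - c) ∈ Metric.ball v₀ r := by
    apply eventually_nhdsWithin_of_eventually_nhds
    have : ContinuousAt (fun δ : ℝ => v₀ - δ • (v₀ - c)) 0 := by fun_prop
    apply this.eventually_mem
    simpa using Metric.ball_mem_nhds v₀ hr
  have hδ3 : ∀ᶠ δ : ℝ in 𝓝[>] 0, 0 < δ ∧ δ < 1 :=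
    (eventually_mem_nhdsWithin).and
      (eventually_nhdsWithin_of_eventually_nhds (gt_mem_nhds one_pos))
  obtain ⟨δ, d1, d2, d3, d4⟩ := (hδ1.and (hδ2.and hδ3)).exists
  have hcD : v₀ - δ • (v₀ - c) ∈ S.D := by
    have := S.hDc.combo_interior_closure_mem_interior (a := δ) (b := 1 - δ)
      (x := c) (y := v₀) (by rwa [S.hDo.interior_eq]) (S.vcl x₀) d3 (by linarith) (by ring)
    rw [S.hDo.interior_eq] at this
    convert this using 1
    module
  have heD : v₀ + δ • (v₀ - c) ∉ closure S.D := by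
    intro he
    have := S.hDc.combo_interior_closure_mem_interior (a := δ * (1 + δ)⁻¹) (b := (1 + δ)⁻¹)
      (x := c) (y := v₀ + δ • (v₀ - c)) (by rwa [S.hDo.interior_eq]) he (by positivity)
      (by positivity) (by field_simp; ring)
    rw [S.hDo.interior_eq] at this
    apply S.vnot x₀
    convert this using 1
    rw [← hv₀]
    have h1 : (1 + δ)⁻¹ * (1 + δ) = 1 := inv_mul_cancel₀ (by positivity)
    calc v₀ = ((1 + δ)⁻¹ * (1 + δ)) • v₀ := by rw [h1, one_smul]
      _ = _ := by module
  -- choose η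
  have hη1 : ∀ᶠ η : ℝ in 𝓝[>] 0, v₀ + δ • (v₀ - c) + η • ψ ∈ Metric.ball v₀ r ∩ (closure S.D)ᶜ := by
    apply eventually_nhdsWithin_of_eventually_nhds
    have : ContinuousAt (fun η : ℝ => v₀ + δ • (v₀ - c) + η • ψ) 0 := by fun_prop
    apply this.eventually_mem
    apply IsOpen.mem_nhds (Metric.isOpen_ball.inter isClosed_closure.isOpen_compl)
    simpa using ⟨by simpa using d1, heD⟩
  have hη2 : ∀ᶠ η : ℝ in 𝓝[>] 0, v₀ - δ • (v₀ - c) + η • ψ ∈ Metric.ball v₀ r ∩ S.D := by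
    apply eventually_nhdsWithin_of_eventually_nhds
    have : ContinuousAt (fun η : ℝ => v₀ - δ • (v₀ - c) + η • ψ) 0 := by fun_prop
    apply this.eventually_mem
    apply IsOpen.mem_nhds (Metric.isOpen_ball.inter S.hDo)
    rw [zero_smul, add_zero]
    exact ⟨d2, hcD⟩
  obtain ⟨η, ⟨e1, e2⟩, ⟨e3, e4⟩, e5⟩ :=
    (hη1.and (hη2.and (eventually_mem_nhdsWithin (a := (0 : ℝ)) (s := Set.Ioi 0)))).exists
  obtain ⟨w, hw, hw1, hw2⟩ := exit_aux S.hDo (convex_segment (𝕜 := ℝ)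
    (v₀ - δ • (v₀ - c) + η • ψ) (v₀ + δ • (v₀ - c) + η • ψ)).isPreconnected
    (left_mem_segment ℝ _ _) (right_mem_segment ℝ _ _) e4 e2
  obtain ⟨hfw, hwN⟩ := hball w ((convex_ball v₀ r).segment_subset e3 e1 hw)
  have hψw : ψ ⬝ᵥ w = η * (ψ ⬝ᵥ ψ) := by
    obtain ⟨a, b, ha, hb, hab, rfl⟩ := hw
    simp only [dotProduct_add, dotProduct_sub, dotProduct_smul, smul_eq_mul, hx, hψc]
    linear_combination (η * (ψ ⬝ᵥ ψ)) * hab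
  obtain ⟨-, x, hxw⟩ := S.vsurj w hw1 hw2 (by rintro rfl; simp at hfw)
  have hvx : S.v x = (S.f w)⁻¹ • w := by
    conv_rhs => rw [hxw]
    simp only [map_smul, S.fv, smul_eq_mul, mul_one]
    rw [smul_smul, inv_mul_cancel₀ hfw.ne', one_smul]
  refine ⟨x, hNU (by rw [Set.mem_preimage, hvx]; exact hwN), ?_⟩
  rw [hvx, dotProduct_smul, hψw, smul_eq_mul]
  have : 0 < η := e5
  positivity

theorem signB {p : Vec} {y₀ : Circle} (hy : S.φ y₀ ⬝ᵥ p = 0) (hind : S.v y₀ ⨯₃ p ≠ 0)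
    (U : Set Circle) (hU : U ∈ 𝓝 y₀) : ∃ x ∈ U, S.φ x ⬝ᵥ p < 0 := by
  obtain ⟨o, ho⟩ := S.hDne
  obtain ⟨t, ht⟩ := parallel_cross hind (S.φv y₀) hy
  have hφo := S.φD y₀ o ho
  set v₀ := S.v y₀ with hv₀
  set Δ := o ⬝ᵥ v₀ ⨯₃ p with hΔ
  have hΔ0 : Δ ≠ 0 := by
    intro h0
    rw [ht, smul_dotProduct, dotProduct_comm, ← hΔ, h0] at hφo
    simp at hφo
  have hcr : ∀ u : Vec, u = (Δ⁻¹ * (u ⬝ᵥ p ⨯₃ o)) • v₀ + (Δ⁻¹ * (u ⬝ᵥ o ⨯₃ v₀)) • p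
      + (Δ⁻¹ * (u ⬝ᵥ v₀ ⨯₃ p)) • o := by
    intro u
    rw [mul_smul, mul_smul, mul_smul, ← smul_add, ← smul_add, ← cramer3, smul_smul,
      inv_mul_cancel₀ hΔ0, one_smul]
  have e1 : v₀ ⬝ᵥ o ⨯₃ v₀ = 0 := dot_cross_self _ _
  have e2 : o ⬝ᵥ o ⨯₃ v₀ = 0 := dot_self_cross _ _
  have e3 : p ⬝ᵥ o ⨯₃ v₀ = Δ := by
    rw [hΔ, triple_product_permutation]
  have e4 : v₀ ⬝ᵥ p ⨯₃ o = Δ := by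
    rw [triple_product_permutation, e3]
  have hαU : ∀ᶠ x in 𝓝 y₀, 0 < Δ⁻¹ * (S.v x ⬝ᵥ p ⨯₃ o) := by
    have hc : Continuous fun x => Δ⁻¹ * (S.v x ⬝ᵥ p ⨯₃ o) := by
      refine continuous_const.mul ?_
      exact cont_dot.comp (S.hv.prodMk continuous_const)
    apply hc.continuousAt.eventually (lt_mem_nhds _)
    show 0 < Δ⁻¹ * (S.v y₀ ⬝ᵥ p ⨯₃ o)
    rw [← hv₀, e4, inv_mul_cancel₀ hΔ0]; norm_num
  obtain ⟨x, ⟨hxU, hα⟩, hβ⟩ := signA (S := S) (ψ := Δ⁻¹ • (o ⨯₃ v₀)) (c := o) (x₀ := y₀)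
    (by
      intro h0
      have : p ⬝ᵥ (Δ⁻¹ • (o ⨯₃ v₀)) = 0 := by rw [h0]; simp
      rw [dotProduct_smul, e3, smul_eq_mul, inv_mul_cancel₀ hΔ0] at this
      norm_num at this)
    (by rw [smul_dotProduct, dotProduct_comm, ← hv₀, e1, smul_zero]) ho
    (by rw [smul_dotProduct, dotProduct_comm, e2, smul_zero]) _ (inter_mem hU hαU)
  have hα' : 0 < Δ⁻¹ * (S.v x ⬝ᵥ p ⨯₃ o) := hα
  rw [smul_dotProduct, dotProduct_comm, smul_eq_mul] at hβ
  have hxy : y₀ ≠ x := by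
    rintro rfl
    rw [← hv₀, e1] at hβ
    simp at hβ
  have hx := hcr (S.v x)
  set α := Δ⁻¹ * (S.v x ⬝ᵥ p ⨯₃ o)
  set β := Δ⁻¹ * (S.v x ⬝ᵥ o ⨯₃ v₀)
  set γ := Δ⁻¹ * (S.v x ⬝ᵥ v₀ ⨯₃ p)
  have q1 : S.φ y₀ ⬝ᵥ S.v x = γ * (S.φ y₀ ⬝ᵥ o) := by
    rw [hx]
    simp only [dotProduct_add, dotProduct_smul, smul_eq_mul, hy]
    rw [hv₀, S.φv]; ring
  have q2 : 0 = α * (S.φ x ⬝ᵥ v₀) + β * (S.φ x ⬝ᵥ p) + γ * (S.φ x ⬝ᵥ o) := by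
    rw [← S.φv x]
    conv_lhs => rw [hx]
    simp only [dotProduct_add, dotProduct_smul, smul_eq_mul]
  have hγ : 0 < γ := by
    have := S.φpos y₀ x hxy
    rw [q1] at this
    exact pos_of_mul_pos_left this hφo.le
  refine ⟨x, hxU, ?_⟩
  by_contra h
  push Not at h
  have r1 := mul_pos hα' (S.φpos x y₀ hxy.symm)
  have r2 := mul_nonneg hβ.le h
  have r3 := mul_pos hγ (S.φD x o ho)
  linarith

theorem out_cross {y z : Circle} (h : y ≠ z) : S.Out (S.φ y ⨯₃ S.φ z) := by
  have aux : ∀ k : ℝ, k ≠ 0 → k • (S.φ y ⨯₃ S.φ z) ∉ closure S.D := by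
    intro k hk hcl
    have h1 : S.φ y ⬝ᵥ k • (S.φ y ⨯₃ S.φ z) = 0 := by simp
    have h2 : S.φ z ⬝ᵥ k • (S.φ y ⨯₃ S.φ z) = 0 := by simp
    by_cases hD : k • (S.φ y ⨯₃ S.φ z) ∈ S.D
    · have := S.φD y _ hD
      linarith
    · obtain ⟨hf, x, hx⟩ := S.vsurj _ hcl hD (smul_ne_zero hk (cross_φ h))
      rw [hx, dotProduct_smul, smul_eq_mul] at h1 h2
      have h1 := (mul_eq_zero.1 h1).resolve_left hf.ne'
      have h2 := (mul_eq_zero.1 h2).resolve_left hf.ne'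
      have hy : y = x := by
        by_contra hh; linarith [S.φpos y x hh]
      have hz : z = x := by
        by_contra hh; linarith [S.φpos z x hh]
      exact h (hy.trans hz.symm)
  refine ⟨cross_φ h, ?_, ?_⟩
  · simpa using aux 1 one_ne_zero
  · simpa using aux (-1) (by norm_num)

theorem cross_ne {p : Vec} (hp : p ≠ 0) {y x : Circle} (h : y ≠ x) (hy : S.φ y ⬝ᵥ p = 0) :
    p ⨯₃ S.v x ≠ 0 := by
  rw [crossProduct_ne_zero_iff_linearIndependent, LinearIndependent.pair_iff]
  intro s t hst
  have h1 : S.φ y ⬝ᵥ (s • p + t • S.v x) = 0 := by rw [hst]; simp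
  rw [dotProduct_add, dotProduct_smul, dotProduct_smul, hy, smul_zero, zero_add, smul_eq_mul] at h1
  have ht : t = 0 := (mul_eq_zero.1 h1).resolve_right (S.φpos y x h).ne'
  subst ht
  simp at hst
  exact ⟨hst.resolve_right hp, rfl⟩

theorem cross_ne' {p : Vec} (hp : p ≠ 0) {y x : Circle} (h : y ≠ x) (hy : S.φ y ⬝ᵥ p = 0) :
    S.v x ⨯₃ p ≠ 0 := by
  rw [← cross_anticomm, neg_ne_zero]
  exact cross_ne hp h hy

/-- The line through an exterior point and a boundary point off its tangents meets `D`. -/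
theorem meets {p : Vec} (hp : p ≠ 0) {x y z : Circle} (hxy : x ≠ y) (hxz : x ≠ z) (hyz : y ≠ z)
    (hy : S.φ y ⬝ᵥ p = 0) (hz : S.φ z ⬝ᵥ p = 0) : ∃ d ∈ S.D, (p ⨯₃ S.v x) ⬝ᵥ d = 0 := by
  by_contra hcon
  push Not at hcon
  obtain ⟨t, ht⟩ := S.uniq (p ⨯₃ S.v x) (cross_ne hp hxy.symm hy) x
    (by rw [dotProduct_comm]; simp) hcon
  have hx : S.φ x ⬝ᵥ p = 0 := by
    rw [ht, smul_dotProduct, dotProduct_comm]; simp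
  exact three_tan hp hx hy hz hxy hxz hyz

theorem off_tan {p ψ c : Vec} (hp : S.Out p) (hψp : ψ ⬝ᵥ p = 0) (hψ : ψ ≠ 0)
    (hc : c ∈ S.D) (hψc : ψ ⬝ᵥ c = 0) {y : Circle} (hy : S.φ y ⬝ᵥ p = 0) :
    ψ ⬝ᵥ S.v y ≠ 0 := by
  intro h
  obtain ⟨a, b, hab, hw⟩ := two_tan hp
  obtain ⟨z, hzy, hz⟩ : ∃ z, z ≠ y ∧ S.φ z ⬝ᵥ p = 0 := by
    rcases (hw y).1 hy with rfl | rfl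
    · exact ⟨b, hab.symm, (hw b).2 (Or.inr rfl)⟩
    · exact ⟨a, hab, (hw a).2 (Or.inl rfl)⟩
  have hcr := cross_ne hp.1 hzy hz
  obtain ⟨s, hs⟩ := parallel_cross hcr hψp h
  obtain ⟨t, ht⟩ := parallel_cross hcr hy (S.φv y)
  have hs0 : s ≠ 0 := by rintro rfl; simp at hs; exact hψ hs
  have h1 := S.φD y c hc
  rw [hs, smul_dotProduct, smul_eq_mul] at hψc
  rw [ht, smul_dotProduct, (mul_eq_zero.1 hψc).resolve_left hs0] at h1
  simp at h1

end CD

end Aux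

section Aux2
open Matrix

theorem mk'_cont {V : Type*} [AddCommGroup V] [Module ℝ V] [TopologicalSpace V] :
    Continuous (Projectivization.mk' ℝ : {v : V // v ≠ 0} → ℙ ℝ V) :=
  continuous_quotient_mk'

theorem mk'_open {V : Type*} [AddCommGroup V] [Module ℝ V] [TopologicalSpace V]
    [ContinuousConstSMul ℝ V] :
    IsOpenMap (Projectivization.mk' ℝ : {v : V // v ≠ 0} → ℙ ℝ V) := by
  intro U hU
  have hq : IsQuotientMap (Projectivization.mk' ℝ : {v : V // v ≠ 0} → ℙ ℝ V) :=
    isQuotientMap_quotient_mk'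
  rw [← hq.isOpen_preimage]
  have : (Projectivization.mk' ℝ : {v : V // v ≠ 0} → ℙ ℝ V) ⁻¹' (Projectivization.mk' ℝ '' U) =
      ⋃ a : ℝˣ, (fun w : {v : V // v ≠ 0} =>
        (⟨a • w.1, (smul_ne_zero_iff_ne a).2 w.2⟩ : {v : V // v ≠ 0})) ⁻¹' U := by
    ext w
    simp only [Set.mem_preimage, Set.mem_image, Set.mem_iUnion]
    constructor
    · rintro ⟨u, hu, huw⟩
      obtain ⟨a, ha⟩ := (Projectivization.mk_eq_mk_iff ℝ _ _ u.2 w.2).1 huw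
      refine ⟨a, ?_⟩
      convert hu
    · rintro ⟨a, ha⟩
      exact ⟨_, ha, (Projectivization.mk_eq_mk_iff ℝ _ _ _ w.2).2 ⟨a, rfl⟩⟩
  rw [this]
  refine isOpen_iUnion fun a => hU.preimage ?_
  refine Continuous.subtype_mk ?_ _
  exact (continuous_const_smul (a : ℝ)).comp continuous_subtype_val

theorem mk_smul {V : Type*} [AddCommGroup V] [Module ℝ V] {a : ℝ} {u : V} (h : a • u ≠ 0)
    (hu : u ≠ 0) : Projectivization.mk ℝ (a • u) h = Projectivization.mk ℝ u hu :=
  (Projectivization.mk_eq_mk_iff' ℝ _ _ _ _).2 ⟨a, rfl⟩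

/-- positive cone over `C` -/
def cone (C : Set (ℙ ℝ (Fin 3 → ℝ))) (f : Vec →ₗ[ℝ] ℝ) : Set Vec :=
  {w | 0 < f w ∧ ∃ h : w ≠ 0, Projectivization.mk ℝ w h ∈ C}

variable {C : Set (ℙ ℝ (Fin 3 → ℝ))} {f : Vec →ₗ[ℝ] ℝ}

theorem f_cont (f : Vec →ₗ[ℝ] ℝ) : Continuous f := LinearMap.continuous_of_finiteDimensional _

theorem cone_open (hC : IsOpen C) : IsOpen (cone C f) := by
  have h1 : IsOpen (Subtype.val '' ((Projectivization.mk' ℝ : {v : Vec // v ≠ 0} → _) ⁻¹' C)) :=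
    (isOpen_ne.isOpenMap_subtype_val) _ (hC.preimage mk'_cont)
  have h2 : IsOpen {w : Vec | 0 < f w} := isOpen_lt continuous_const (f_cont f)
  convert h2.inter h1 using 1
  ext w
  simp [cone]

theorem cone_smul {d : Vec} (hd : d ∈ cone C f) {t : ℝ} (ht : 0 < t) : t • d ∈ cone C f := by
  obtain ⟨h1, h2, h3⟩ := hd
  refine ⟨by simp; positivity, smul_ne_zero ht.ne' h2, ?_⟩
  rwa [mk_smul _ h2]

theorem cone_convex
    (hK : Convex ℝ {w : Fin 3 → ℝ | f w = 1 ∧ ∃ hw : w ≠ 0, Projectivization.mk ℝ w hw ∈ C}) :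
    Convex ℝ (cone C f) := by
  have key : ∀ d ∈ cone C f, f ((f d)⁻¹ • d) = 1 ∧
      ∃ hw : (f d)⁻¹ • d ≠ 0, Projectivization.mk ℝ ((f d)⁻¹ • d) hw ∈ C := by
    intro d hd
    have hd0 := hd.1
    refine ⟨by simp [hd0.ne'], ?_⟩
    exact (cone_smul hd (inv_pos.2 hd0)).2
  intro a ha b hb s t hs ht hst
  have fa := ha.1
  have fb := hb.1
  have hpos : 0 < s * f a + t * f b := by
    rcases hs.lt_or_eq with h | rfl
    · have := mul_pos h fa
      have := mul_nonneg ht fb.le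
      linarith
    · have : t = 1 := by linarith
      simp [this, fb]
  set r := s * f a + t * f b with hr
  have := hK (key a ha) (key b hb) (a := s * f a * r⁻¹) (b := t * f b * r⁻¹) (by positivity)
    (by positivity) (by rw [← add_mul, ← hr, mul_inv_cancel₀ hpos.ne'])
  have e : (s * f a * r⁻¹) • (f a)⁻¹ • a + (t * f b * r⁻¹) • (f b)⁻¹ • b =
      r⁻¹ • (s • a + t • b) := by
    rw [smul_smul, smul_smul, smul_add, smul_smul, smul_smul]
    congr 2 <;> field_simp
  rw [e] at this
  obtain ⟨g1, g2, g3⟩ := this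
  have hne : s • a + t • b ≠ 0 := fun h => g2 (by rw [h, smul_zero])
  refine ⟨by simpa [hr] using hpos, hne, ?_⟩
  rwa [mk_smul _ hne] at g3

theorem mem_cone_iff (hf : ∀ (v : Fin 3 → ℝ) (hv : v ≠ 0),
      Projectivization.mk ℝ v hv ∈ closure C → f v ≠ 0) {u : Vec} (h : u ≠ 0) :
    Projectivization.mk ℝ u h ∈ C ↔ u ∈ cone C f ∨ -u ∈ cone C f := by
  have hneg : Projectivization.mk ℝ (-u) (neg_ne_zero.2 h) = Projectivization.mk ℝ u h :=
    (Projectivization.mk_eq_mk_iff' ℝ _ _ _ _).2 ⟨-1, by simp⟩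
  constructor
  · intro hu
    rcases (hf u h (subset_closure hu)).lt_or_gt with h0 | h0
    · exact Or.inr ⟨by simpa using h0, neg_ne_zero.2 h, by rwa [hneg]⟩
    · exact Or.inl ⟨h0, h, hu⟩
  · rintro (⟨-, h1, h2⟩ | ⟨-, h1, h2⟩)
    · exact h2
    · rwa [hneg] at h2

theorem mem_closure_cone {u : Vec} (h : u ≠ 0)
    (hu : Projectivization.mk ℝ u h ∈ closure C) (hfu : 0 < f u) : u ∈ closure (cone C f) := by
  rw [mem_closure_iff] at hu ⊢
  intro O hO huO
  obtain ⟨q, ⟨⟨w, hw⟩, ⟨hw1, hw2⟩, rfl⟩, hqC⟩ := hu _ (mk'_open _ ((hO.inter (isOpen_lt continuous_const (f_cont f))).preimage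
    (continuous_subtype_val (p := fun v : Vec => v ≠ 0)))) ⟨⟨u, h⟩, ⟨huO, hfu⟩, rfl⟩
  exact ⟨w, hw1, hw2, hw, hqC⟩

theorem closure_cone_mem {u : Vec} (h : u ≠ 0) (hu : u ∈ closure (cone C f)) :
    Projectivization.mk ℝ u h ∈ closure C := by
  rw [mem_closure_iff] at hu ⊢
  intro O hO huO
  have h1 : IsOpen (Subtype.val '' ((Projectivization.mk' ℝ : {v : Vec // v ≠ 0} → _) ⁻¹' O)) :=
    (isOpen_ne.isOpenMap_subtype_val) _ (hO.preimage mk'_cont)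
  obtain ⟨_, ⟨w, hw, rfl⟩, hw2⟩ := hu _ h1 ⟨⟨u, h⟩, huO, rfl⟩
  exact ⟨_, hw, hw2.2.2⟩

theorem closure_cone_pos (hf : ∀ (v : Fin 3 → ℝ) (hv : v ≠ 0),
      Projectivization.mk ℝ v hv ∈ closure C → f v ≠ 0) {u : Vec} (h : u ≠ 0)
    (hu : u ∈ closure (cone C f)) : 0 < f u := by
  have h1 := hf u h (closure_cone_mem h hu)
  have h2 : 0 ≤ f u := by
    have : closure (cone C f) ⊆ {w | 0 ≤ f w} :=
      closure_minimal (fun w hw => hw.1.le) (isClosed_le continuous_const (f_cont f))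
    exact this hu
  exact lt_of_le_of_ne h2 h1.symm

theorem mem_closure_cone_iff (hf : ∀ (v : Fin 3 → ℝ) (hv : v ≠ 0),
      Projectivization.mk ℝ v hv ∈ closure C → f v ≠ 0) {u : Vec} (h : u ≠ 0) :
    Projectivization.mk ℝ u h ∈ closure C ↔
      u ∈ closure (cone C f) ∨ -u ∈ closure (cone C f) := by
  have hneg : Projectivization.mk ℝ (-u) (neg_ne_zero.2 h) = Projectivization.mk ℝ u h :=
    (Projectivization.mk_eq_mk_iff' ℝ _ _ _ _).2 ⟨-1, by simp⟩
  constructor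
  · intro hu
    rcases (hf u h hu).lt_or_gt with h0 | h0
    · exact Or.inr (mem_closure_cone (neg_ne_zero.2 h) (by rwa [hneg]) (by simpa using h0))
    · exact Or.inl (mem_closure_cone h hu h0)
  · rintro (h2 | h2)
    · exact closure_cone_mem h h2
    · have := closure_cone_mem (neg_ne_zero.2 h) h2
      rwa [hneg] at this

theorem ker_finrank {w : Vec} (hw : w ≠ 0) :
    finrank ℝ (LinearMap.ker (dotProductEquiv ℝ (Fin 3) w)) = 2 := by
  have h0 : dotProductEquiv ℝ (Fin 3) w ≠ 0 := by simpa using hw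
  have := Module.Dual.finrank_ker_add_one_of_ne_zero h0
  simp at this
  omega

theorem exists_normal {W : Submodule ℝ Vec} (hW : finrank ℝ W = 2) :
    ∃ w : Vec, w ≠ 0 ∧ ∀ u, u ∈ W ↔ w ⬝ᵥ u = 0 := by
  have hlt : W < ⊤ := by
    rw [lt_top_iff_ne_top]
    rintro rfl
    simp at hW
  obtain ⟨g, hg, hgW⟩ := Submodule.exists_le_ker_of_lt_top W hlt
  obtain ⟨w, rfl⟩ := (dotProductEquiv ℝ (Fin 3)).surjective g
  have hw : w ≠ 0 := by rintro rfl; simp at hg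
  refine ⟨w, hw, fun u => ?_⟩
  have : W = LinearMap.ker (dotProductEquiv ℝ (Fin 3) w) :=
    Submodule.eq_of_le_of_finrank_eq hgW (by rw [hW, ker_finrank hw])
  rw [this, LinearMap.mem_ker]
  simp

theorem G_cont {u : Vec} (h : u ≠ 0) (hfu : f u ≠ 0) :
    ContinuousAt (fun p : ℙ ℝ Vec => (f p.rep)⁻¹ • p.rep) (Projectivization.mk ℝ u h) := by
  have hG : ∀ (w : Vec) (hw : w ≠ 0), (f (Projectivization.mk ℝ w hw).rep)⁻¹ •
      (Projectivization.mk ℝ w hw).rep = (f w)⁻¹ • w := by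
    intro w hw
    obtain ⟨a, ha⟩ := Projectivization.exists_smul_eq_mk_rep ℝ w hw
    rw [← ha]
    have ha0 : (a : ℝ) ≠ 0 := a.ne_zero
    rw [Units.smul_def, map_smul, smul_smul, smul_eq_mul, mul_inv, mul_right_comm,
      inv_mul_cancel₀ ha0, one_mul]
  have h1 : 𝓝 (Projectivization.mk ℝ u h) ≤
      map (Projectivization.mk' ℝ) (𝓝 (⟨u, h⟩ : {v : Vec // v ≠ 0})) :=
    mk'_open.nhds_le ⟨u, h⟩
  refine Tendsto.mono_left ?_ h1
  rw [tendsto_map'_iff]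
  show Tendsto _ _ (𝓝 ((f (Projectivization.mk ℝ u h).rep)⁻¹ •
      (Projectivization.mk ℝ u h).rep))
  rw [hG]
  have : (fun p : ℙ ℝ Vec => (f p.rep)⁻¹ • p.rep) ∘ Projectivization.mk' ℝ =
      fun w : {v : Vec // v ≠ 0} => (f w.1)⁻¹ • w.1 := by
    ext1 w
    exact hG w.1 w.2
  rw [this]
  have hc : ContinuousAt (fun w : {v : Vec // v ≠ 0} => (f w.1)⁻¹ • w.1) ⟨u, h⟩ := by
    have g1 : ContinuousAt (fun w : {v : Vec // v ≠ 0} => f w.1) ⟨u, h⟩ :=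
      ((f_cont f).comp continuous_subtype_val).continuousAt
    have g2 : ContinuousAt (fun w : {v : Vec // v ≠ 0} => w.1) ⟨u, h⟩ :=
      continuous_subtype_val.continuousAt
    exact (g1.inv₀ hfu).smul g2
  exact hc

end Aux2

section Aux3
open Matrix

theorem pos_of_nonneg_open {D : Set Vec} (hD : IsOpen D) {ψ : Vec} (hψ : ψ ≠ 0)
    (h : ∀ d ∈ D, 0 ≤ ψ ⬝ᵥ d) : ∀ d ∈ D, 0 < ψ ⬝ᵥ d := by
  intro d hd
  refine lt_of_le_of_ne (h d hd) fun h0 => ?_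
  have hc : Continuous fun e : ℝ => d - e • ψ := by fun_prop
  have h1 : ∀ᶠ e in 𝓝 (0 : ℝ), d - e • ψ ∈ D :=
    hc.continuousAt.eventually (hD.mem_nhds (by simpa using hd))
  have h2 : ∀ᶠ e in 𝓝[>] (0 : ℝ), d - e • ψ ∈ D := h1.filter_mono nhdsWithin_le_nhds
  obtain ⟨e, he, he0⟩ := (h2.and self_mem_nhdsWithin).exists
  have h3 := h _ he
  have h4 : 0 < ψ ⬝ᵥ ψ := by
    refine lt_of_le_of_ne ?_ fun h => hψ (dotProduct_self_eq_zero.1 h.symm)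
    exact Finset.sum_nonneg fun i _ => mul_self_nonneg _
  rw [dotProduct_sub, dotProduct_smul, ← h0] at h3
  have h5 := mul_pos (show (0:ℝ) < e from he0) h4
  simp only [smul_eq_mul] at h3
  linarith

theorem phi_cont {D : Set Vec} (hD : IsOpen D) {o : Vec} (ho : o ∈ D) {v φ : Circle → Vec}
    (hv : Continuous v) (φo : ∀ x, φ x ⬝ᵥ o = 1) (φv : ∀ x, φ x ⬝ᵥ v x = 0)
    (φD : ∀ x, ∀ d ∈ D, 0 < φ x ⬝ᵥ d)
    (uniq : ∀ ψ x, ψ ⬝ᵥ o = 1 → ψ ⬝ᵥ v x = 0 → (∀ d ∈ D, 0 < ψ ⬝ᵥ d) → ψ = φ x) :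
    Continuous φ := by
  obtain ⟨r, hr, hb⟩ := Metric.isOpen_iff.1 hD o ho
  have hbd : ∀ x, φ x ∈ Metric.closedBall (0 : Vec) (2 / r) := by
    intro x
    rw [mem_closedBall_zero_iff, pi_norm_le_iff_of_nonneg (by positivity)]
    intro i
    have hs : ∀ s : ℝ, |s| ≤ r / 2 → 0 < 1 + s * φ x i := by
      intro s hs
      have hm : o + s • (Pi.single i 1 : Vec) ∈ D := by
        apply hb
        rw [Metric.mem_ball, dist_eq_norm, add_sub_cancel_left]
        rw [← Pi.single_smul, smul_eq_mul, mul_one, Pi.norm_single, Real.norm_eq_abs]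
        linarith
      have := φD x _ hm
      rw [dotProduct_add, φo, dotProduct_smul, dotProduct_single_one, smul_eq_mul] at this
      exact this
    have a1 := hs (r / 2) (by rw [abs_of_pos (by linarith)])
    have a2 := hs (-(r / 2)) (by rw [abs_neg, abs_of_pos (by linarith)])
    rw [Real.norm_eq_abs, abs_le]
    constructor
    · rw [← neg_div, div_le_iff₀ hr]; linarith
    · rw [le_div_iff₀ hr]; linarith
  rw [continuous_iff_continuousAt]
  intro x
  refine (isCompact_closedBall (0 : Vec) (2 / r)).tendsto_nhds_of_unique_mapClusterPt
    (Eventually.of_forall hbd) ?_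
  intro ψ _ hψ
  obtain ⟨U, hU, hUt⟩ := mapClusterPt_iff_ultrafilter.1 hψ
  have hlim : ∀ (w : Circle → Vec) (w0 : Vec), Tendsto w U (𝓝 w0) →
      Tendsto (fun x => φ x ⬝ᵥ w x) U (𝓝 (ψ ⬝ᵥ w0)) := fun w w0 hw =>
    (cont_dot.tendsto (ψ, w0)).comp (hUt.prodMk_nhds hw)
  have ho1 : ψ ⬝ᵥ o = 1 := by
    refine tendsto_nhds_unique (hlim (fun _ => o) o tendsto_const_nhds) ?_
    simp only [φo]; exact tendsto_const_nhds
  refine uniq ψ x ho1 ?_ ?_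
  · refine tendsto_nhds_unique (hlim v (v x) ((hv.tendsto x).mono_left hU)) ?_
    simp only [φv]; exact tendsto_const_nhds
  · refine pos_of_nonneg_open hD ?_ ?_
    · rintro rfl; simp at ho1
    · intro d hd
      exact ge_of_tendsto' (hlim (fun _ => d) d tendsto_const_nhds) fun y => (φD y d hd).le

theorem sub_iff {u : Vec} (h : u ≠ 0) (W : Submodule ℝ Vec) :
    (Projectivization.mk ℝ u h).submodule ≤ W ↔ u ∈ W := by
  rw [Projectivization.submodule_mk, Submodule.span_singleton_le_iff_mem]

theorem build
    (C : Set (ℙ ℝ (Fin 3 → ℝ))) (hCopen : IsOpen C) (hCpc : ProperlyConvex C)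
    (hstrict : StrictlyConvexBoundary C)
    (hC1 : ∀ p ∈ frontier C, ∃! W : Submodule ℝ (Fin 3 → ℝ), IsSupportingLineAt C W p)
    (ξ₁ : Circle → ℙ ℝ (Fin 3 → ℝ))
    (hξ₁ : ∃ e : Circle ≃ₜ frontier C, ∀ x, (e x : ℙ ℝ (Fin 3 → ℝ)) = ξ₁ x)
    (ξ₂ : Circle → Submodule ℝ (Fin 3 → ℝ))
    (hξ₂ : ∀ x, IsSupportingLineAt C (ξ₂ x) (ξ₁ x)) :
    ∃ S : CD, (∀ x, (ξ₁ x).submodule = Submodule.span ℝ {S.v x}) ∧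
      (∀ x u, u ∈ ξ₂ x ↔ S.φ x ⬝ᵥ u = 0) ∧
      (∀ p (h : p ≠ 0), Projectivization.mk ℝ p h ∉ closure C ↔ S.Out p) ∧
      (∀ u (h : u ≠ 0), Projectivization.mk ℝ u h ∈ C ↔ u ∈ S.D ∨ -u ∈ S.D) := by
  obtain ⟨f, hf, hK⟩ := hCpc
  obtain ⟨e, he⟩ := hξ₁
  have hfr : frontier C = closure C \ C := hCopen.frontier_eq
  have hξcl : ∀ x, ξ₁ x ∈ closure C := fun x => frontier_subset_closure (he x ▸ (e x).2)
  have hξfr : ∀ x, ξ₁ x ∈ frontier C := fun x => (he x ▸ (e x).2)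
  have hξc : Continuous ξ₁ := by
    have : ξ₁ = fun x => (e x : ℙ ℝ Vec) := by ext1 x; exact (he x).symm
    rw [this]; exact continuous_subtype_val.comp e.continuous
  have hξinj : Function.Injective ξ₁ := by
    intro x y hxy
    exact e.injective (Subtype.ext (by rw [he, he, hxy]))
  have hξsurj : ∀ p ∈ frontier C, ∃ x, ξ₁ x = p := by
    intro p hp
    exact ⟨e.symm ⟨p, hp⟩, by rw [← he]; simp⟩
  have hfr0 : ∀ x, f (ξ₁ x).rep ≠ 0 := by
    intro x
    refine hf _ (Projectivization.rep_nonzero _) ?_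
    rw [Projectivization.mk_rep]; exact hξcl x
  set v : Circle → Vec := fun x => (f (ξ₁ x).rep)⁻¹ • (ξ₁ x).rep with hvdef
  have fv : ∀ x, f (v x) = 1 := by
    intro x
    simp [hvdef, hfr0 x]
  have vne : ∀ x, v x ≠ 0 := by
    intro x h
    have := fv x
    rw [h, map_zero] at this
    exact zero_ne_one this
  have vmk : ∀ x, Projectivization.mk ℝ (v x) (vne x) = ξ₁ x := by
    intro x
    rw [mk_smul _ (Projectivization.rep_nonzero _), Projectivization.mk_rep]
  have hv : Continuous v := by
    rw [continuous_iff_continuousAt]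
    intro x
    have h1 := G_cont (f := f) (Projectivization.rep_nonzero (ξ₁ x)) (hfr0 x)
    rw [Projectivization.mk_rep] at h1
    exact ContinuousAt.comp (f := ξ₁) (x := x) h1 hξc.continuousAt
  clear_value v
  have vinj : Function.Injective v := by
    intro x y hxy
    apply hξinj
    rw [← vmk, ← vmk]
    congr 1
  set D := cone C f with hDdef
  have hDo : IsOpen D := cone_open hCopen
  have hDc : Convex ℝ D := cone_convex hK
  have vcl : ∀ x, v x ∈ closure D := by
    intro x
    refine mem_closure_cone (vne x) ?_ (by rw [fv]; exact one_pos)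
    rw [vmk]; exact hξcl x
  have vnot : ∀ x, v x ∉ D := by
    intro x hx
    have h1 := hx.2.2
    rw [vmk] at h1
    have h2 := hξfr x
    rw [hfr] at h2
    exact h2.2 h1
  have hDne : D.Nonempty := closure_nonempty_iff.1 ⟨_, vcl 1⟩
  have vsurj : ∀ u ∈ closure D, u ∉ D → u ≠ 0 → 0 < f u ∧ ∃ x, u = f u • v x := by
    intro u hu huD hu0
    have hfu : 0 < f u := closure_cone_pos hf hu0 hu
    refine ⟨hfu, ?_⟩
    have h1 : Projectivization.mk ℝ u hu0 ∈ frontier C := by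
      rw [hfr]
      refine ⟨closure_cone_mem hu0 hu, fun h => huD ⟨hfu, hu0, h⟩⟩
    obtain ⟨x, hx⟩ := hξsurj _ h1
    refine ⟨x, ?_⟩
    rw [← vmk] at hx
    obtain ⟨a, ha⟩ := (Projectivization.mk_eq_mk_iff' ℝ _ _ _ _).1 hx.symm
    have : f u = a := by rw [← ha, map_smul, fv]; simp
    rw [this, ha]
  obtain ⟨o, ho⟩ := hDne
  have hn : ∀ x, ∃ w : Vec, w ⬝ᵥ o = 1 ∧ (∀ u, u ∈ ξ₂ x ↔ w ⬝ᵥ u = 0) := by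
    intro x
    obtain ⟨hW, -, -, hdis⟩ := hξ₂ x
    obtain ⟨w, hw, hwW⟩ := exists_normal hW
    have h0 : w ⬝ᵥ o ≠ 0 := by
      intro h
      have : Projectivization.mk ℝ o ho.2.1 ∈ projLine (ξ₂ x) ∩ C :=
        ⟨(sub_iff _ _).2 ((hwW o).2 h), ho.2.2⟩
      rw [hdis] at this
      exact this
    refine ⟨(w ⬝ᵥ o)⁻¹ • w, by rw [smul_dotProduct, smul_eq_mul, inv_mul_cancel₀ h0], fun u => ?_⟩
    rw [hwW, smul_dotProduct, smul_eq_mul, mul_eq_zero, or_iff_right (inv_ne_zero h0)]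
  choose φ φo φW using hn
  have φ0 : ∀ x, φ x ≠ 0 := by
    intro x h
    have := φo x
    rw [h, zero_dotProduct] at this
    exact zero_ne_one this
  have φv : ∀ x, φ x ⬝ᵥ v x = 0 := by
    intro x
    rw [← φW, ← sub_iff (vne x), vmk]
    exact (hξ₂ x).2.2.1
  have sgn : ∀ ψ : Vec, ψ ⬝ᵥ o = 1 → (∀ d ∈ D, ψ ⬝ᵥ d ≠ 0) → ∀ d ∈ D, 0 < ψ ⬝ᵥ d := by
    intro ψ h1 h2 d hd
    by_contra hle
    push Not at hle
    have hpc := hDc.isPreconnected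
    have hcont : ContinuousOn (fun u : Vec => ψ ⬝ᵥ u) D :=
      (cont_dot.comp (continuous_const.prodMk continuous_id)).continuousOn
    obtain ⟨c, hc, hc0⟩ := hpc.intermediate_value hd ho hcont
      (show (0:ℝ) ∈ Set.Icc _ _ from ⟨hle, by rw [h1]; exact zero_le_one⟩)
    exact h2 c hc hc0
  have φD : ∀ x, ∀ d ∈ D, 0 < φ x ⬝ᵥ d := by
    intro x
    refine sgn _ (φo x) fun d hd h => ?_
    have : Projectivization.mk ℝ d hd.2.1 ∈ projLine (ξ₂ x) ∩ C :=
        ⟨(sub_iff _ _).2 ((φW x d).2 h), hd.2.2⟩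
    rw [(hξ₂ x).2.2.2] at this
    exact this
  have uniq0 : ∀ ψ : Vec, ψ ≠ 0 → ∀ x, ψ ⬝ᵥ v x = 0 → (∀ d ∈ D, ψ ⬝ᵥ d ≠ 0) →
      φ x = (ψ ⬝ᵥ o)⁻¹ • ψ := by
    intro ψ hψ x hx hd
    have hs : IsSupportingLineAt C (LinearMap.ker (dotProductEquiv ℝ (Fin 3) ψ)) (ξ₁ x) := by
      refine ⟨ker_finrank hψ, hξfr x, ?_, ?_⟩
      · rw [← vmk, sub_iff]; simpa using hx
      · rw [Set.eq_empty_iff_forall_notMem]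
        rintro q ⟨hq1, hq2⟩
        induction q using Projectivization.ind with
        | h u hu =>
          have hu1 : ψ ⬝ᵥ u = 0 := by
            have := (sub_iff hu _).1 hq1
            simpa using this
          rcases (mem_cone_iff hf hu).1 hq2 with h | h
          · exact hd _ h hu1
          · exact hd _ h (by simp [hu1])
    have heq : LinearMap.ker (dotProductEquiv ℝ (Fin 3) ψ) = ξ₂ x :=
      (hC1 _ (hξfr x)).unique hs (hξ₂ x)
    have hmem : ∀ u, ψ ⬝ᵥ u = 0 → φ x ⬝ᵥ u = 0 := by
      intro u hu
      rw [← φW, ← heq]; simpa using hu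
    have h0 := hd o ho
    refine dotProduct_eq _ _ fun u => ?_
    have h3 := hmem (u - ((ψ ⬝ᵥ o)⁻¹ * (ψ ⬝ᵥ u)) • o) (by
      rw [dotProduct_sub, dotProduct_smul, smul_eq_mul]; field_simp; simp)
    rw [dotProduct_sub, dotProduct_smul, φo, smul_eq_mul, mul_one] at h3
    rw [smul_dotProduct, smul_eq_mul]
    linarith
  have hφ : Continuous φ := by
    refine phi_cont hDo ho hv φo φv φD ?_
    intro ψ x h1 h2 h3
    rw [uniq0 ψ (by rintro rfl; simp at h1) x h2 fun d hd => (h3 d hd).ne', h1]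
    simp
  have three : ∀ ψ : Vec, ψ ≠ 0 → ∀ a b c, ψ ⬝ᵥ v a = 0 → ψ ⬝ᵥ v b = 0 → ψ ⬝ᵥ v c = 0 →
    a ≠ b → a ≠ c → b ≠ c → False := by
    intro ψ hψ a b c ha hb hc hab hac hbc
    refine hstrict (ξ₁ a) (ξ₁ b) (ξ₁ c) (hξfr a) (hξfr b) (hξfr c) (hξinj.ne hab) (hξinj.ne hac)
      (hξinj.ne hbc) (LinearMap.ker (dotProductEquiv ℝ (Fin 3) ψ)) (ker_finrank hψ) ?_
    rw [← vmk a, ← vmk b, ← vmk c, sub_iff, sub_iff, sub_iff]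
    simp [ha, hb, hc]
  have φpos : ∀ x y, x ≠ y → 0 < φ x ⬝ᵥ v y := by
    intro x y hxy
    have hge : 0 ≤ φ x ⬝ᵥ v y := by
      have hcl : IsClosed {u : Vec | 0 ≤ φ x ⬝ᵥ u} :=
        isClosed_le continuous_const (cont_dot.comp (continuous_const.prodMk continuous_id))
      exact closure_minimal (fun u hu => (φD x u hu).le) hcl (vcl y)
    refine lt_of_le_of_ne hge fun h0 => ?_
    set m : Vec := (1/2 : ℝ) • v x + (1/2 : ℝ) • v y with hm
    have hmcl : m ∈ closure D :=
      hDc.closure (vcl x) (vcl y) (by norm_num) (by norm_num) (by norm_num)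
    have hm0 : φ x ⬝ᵥ m = 0 := by
      rw [hm, dotProduct_add, dotProduct_smul, dotProduct_smul, φv, ← h0]; simp
    have hfm : f m = 1 := by
      rw [hm, map_add, map_smul, map_smul, fv, fv]; norm_num
    have hmne : m ≠ 0 := by
      intro h; rw [h, map_zero] at hfm; exact zero_ne_one hfm
    obtain ⟨-, z, hz⟩ := vsurj m hmcl (fun h => (φD x m h).ne' hm0) hmne
    rw [hfm, one_smul] at hz
    have hne : v x - v y ≠ 0 := sub_ne_zero.2 (vinj.ne hxy)
    refine three (φ x) (φ0 x) x y z (φv x) h0.symm (hz ▸ hm0) hxy ?_ ?_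
    · rintro rfl
      apply hne
      have : (2:ℝ) • m - v x - v x = 0 := by rw [hz, two_smul]; abel
      have h5 : (2:ℝ) • m = v x + v y := by rw [hm, smul_add, smul_smul, smul_smul]; norm_num
      rw [h5] at this
      rw [← neg_eq_zero, ← this]; abel
    · rintro rfl
      apply hne
      have : (2:ℝ) • m - v y - v y = 0 := by rw [hz, two_smul]; abel
      have h5 : (2:ℝ) • m = v x + v y := by rw [hm, smul_add, smul_smul, smul_smul]; norm_num
      rw [h5] at this
      rw [← this]; abel
  refine ⟨⟨D, f, v, φ, hDo, hDc, fun d hd t ht => cone_smul hd ht, ⟨o, ho⟩, hv, hφ, fv, vcl, vnot,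
    vinj, vsurj, φv, φD, φpos, three, fun ψ hψ x hx hd => ⟨_, uniq0 ψ hψ x hx hd⟩⟩, ?_, φW, ?_, ?_⟩
  · intro x
    show _ = Submodule.span ℝ {v x}
    rw [← vmk, Projectivization.submodule_mk]
  · intro p h
    rw [mem_closure_cone_iff hf h]
    simp [CD.Out, h, hDdef]
  · intro u h
    exact mem_cone_iff hf h

end Aux3

section Aux4
open Matrix

theorem piRing_dpe (w : Vec) :
    LinearEquiv.piRing ℝ ℝ (Fin 3) ℝ (dotProductEquiv ℝ (Fin 3) w) = w := by
  ext i
  simp [LinearEquiv.piRing_apply]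

theorem dpe_cont : Continuous (dotProductEquiv ℝ (Fin 3)) := by
  refine continuous_induced_rng.2 ?_
  convert continuous_id using 1
  ext1 w
  exact piRing_dpe w

theorem dpe_open : IsOpenMap (dotProductEquiv ℝ (Fin 3)) := by
  intro U hU
  refine isOpen_induced_iff.2 ⟨U, hU, ?_⟩
  ext g
  obtain ⟨w, rfl⟩ := (dotProductEquiv ℝ (Fin 3)).surjective g
  rw [Set.mem_preimage, piRing_dpe]
  simp

theorem dual_csmul : ContinuousConstSMul ℝ (Module.Dual ℝ (Fin 3 → ℝ)) := by
  refine ⟨fun c => continuous_induced_rng.2 ?_⟩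
  have : (⇑(LinearEquiv.piRing ℝ ℝ (Fin 3) ℝ) ∘ fun g : Module.Dual ℝ (Fin 3 → ℝ) => c • g) =
      fun g => c • LinearEquiv.piRing ℝ ℝ (Fin 3) ℝ g := by
    ext1 g; simp
  rw [this]
  exact continuous_induced_dom.const_smul c

theorem dpe_ne {w : Vec} (h : w ≠ 0) : dotProductEquiv ℝ (Fin 3) w ≠ 0 := by simpa using h

/-- the projective line with normal vector -/
def q2 (w : {w : Vec // w ≠ 0}) : ℙ ℝ (Module.Dual ℝ (Fin 3 → ℝ)) :=
  Projectivization.mk' ℝ ⟨dotProductEquiv ℝ (Fin 3) w.1, dpe_ne w.2⟩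

theorem q2_cont : Continuous q2 :=
  mk'_cont.comp ((dpe_cont.comp continuous_subtype_val).subtype_mk _)

theorem q2_open : IsOpenMap q2 := by
  have := dual_csmul
  refine mk'_open.comp (f := fun w : {w : Vec // w ≠ 0} =>
    (⟨dotProductEquiv ℝ (Fin 3) w.1, dpe_ne w.2⟩ : {g : Module.Dual ℝ (Fin 3 → ℝ) // g ≠ 0})) ?_
  refine IsOpenMap.subtype_mk ?_ _
  exact dpe_open.comp (isOpen_ne.isOpenMap_subtype_val)

theorem q2_sub (w : {w : Vec // w ≠ 0}) :
    (q2 w).submodule = Submodule.span ℝ {dotProductEquiv ℝ (Fin 3) w.1} :=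
  Projectivization.submodule_mk _ _

theorem q2_surj (q : ℙ ℝ (Module.Dual ℝ (Fin 3 → ℝ))) : ∃ w, q2 w = q := by
  induction q using Projectivization.ind with
  | h g hg =>
    obtain ⟨w, rfl⟩ := (dotProductEquiv ℝ (Fin 3)).surjective g
    exact ⟨⟨w, fun h => hg (by rw [h, map_zero])⟩, rfl⟩

theorem q2_eq {a b : {w : Vec // w ≠ 0}} : q2 a = q2 b ↔ ∃ t : ℝ, t • b.1 = a.1 := by
  refine (Projectivization.mk_eq_mk_iff' ℝ _ _ _ _).trans ?_
  refine exists_congr fun t => ?_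
  rw [← map_smul, EmbeddingLike.apply_eq_iff_eq]

theorem q2_mem (w : {w : Vec // w ≠ 0}) {u : Vec} (h : u ≠ 0) :
    (Projectivization.mk ℝ u h).submodule ≤ (q2 w).submodule.dualCoannihilator ↔ w.1 ⬝ᵥ u = 0 := by
  rw [sub_iff, q2_sub, ← SetLike.mem_coe, Submodule.coe_dualCoannihilator_span]
  simp

/-- compatibility of cone data with a projective set -/
def Rep (S : CD) (C : Set (ℙ ℝ (Fin 3 → ℝ))) : Prop :=
  (∀ p (h : p ≠ 0), Projectivization.mk ℝ p h ∉ closure C ↔ S.Out p) ∧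
      (∀ u (h : u ≠ 0), Projectivization.mk ℝ u h ∈ C ↔ u ∈ S.D ∨ -u ∈ S.D)

variable {S : CD} {C : Set (ℙ ℝ (Fin 3 → ℝ))}

theorem zero_notMem (S : CD) : (0 : Vec) ∉ S.D := by
  intro h
  have := S.φD 1 0 h
  simp at this

/-- a pair of nonzero vectors as a pair of projective points -/
def qq (a : {w : Vec // w ≠ 0} × {w : Vec // w ≠ 0}) :
    ℙ ℝ (Fin 3 → ℝ) × ℙ ℝ (Module.Dual ℝ (Fin 3 → ℝ)) :=
  (Projectivization.mk' ℝ a.1, q2 a.2)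

theorem qq_cont : Continuous qq := mk'_cont.prodMap q2_cont

theorem qq_open : IsOpenMap qq := mk'_open.prodMap q2_open

theorem qq_surj (b) : ∃ a, qq a = b := by
  obtain ⟨b1, b2⟩ := b
  obtain ⟨w, rfl⟩ := q2_surj b2
  induction b1 using Projectivization.ind with
  | h u hu => exact ⟨(⟨u, hu⟩, w), rfl⟩

theorem mem_Omega (hR : Rep S C) (a : {w : Vec // w ≠ 0} × {w : Vec // w ≠ 0}) :
    qq a ∈ Omega2 C ↔ a.2.1 ⬝ᵥ a.1.1 = 0 ∧ S.Out a.1.1 ∧ ∃ c ∈ S.D, a.2.1 ⬝ᵥ c = 0 := by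
  obtain ⟨⟨p, hp⟩, w⟩ := a
  refine and_congr (q2_mem w hp) (and_congr (hR.1 p hp) ?_)
  constructor
  · rintro ⟨q, hq, hqw⟩
    induction q using Projectivization.ind with
    | h u hu =>
      have h1 := (q2_mem w hu).1 hqw
      rcases (hR.2 u hu).1 hq with h | h
      · exact ⟨u, h, h1⟩
      · exact ⟨-u, h, by simp [h1]⟩
  · rintro ⟨c, hc, hwc⟩
    have hc0 : c ≠ 0 := fun h => zero_notMem S (h ▸ hc)
    exact ⟨Projectivization.mk ℝ c hc0, (hR.2 c hc0).2 (Or.inl hc), (q2_mem w hc0).2 hwc⟩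

/-- the space of positive triples -/
abbrev T := {t : Circle × Circle × Circle // PosOriented t.1 t.2.1 t.2.2}

variable (S) in
def PP (t : T) : Vec := S.φ t.1.2.1 ⨯₃ S.φ t.1.2.2

variable (S) in
def NN (t : T) : Vec := PP S t ⨯₃ S.v t.1.1

theorem PP_out (t : T) : S.Out (PP S t) := CD.out_cross (pos_ne t.2).2.2

theorem PP_y (t : T) : S.φ t.1.2.1 ⬝ᵥ PP S t = 0 := dot_self_cross _ _

theorem PP_z (t : T) : S.φ t.1.2.2 ⬝ᵥ PP S t = 0 := dot_cross_self _ _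

theorem NN_ne (t : T) : NN S t ≠ 0 :=
  CD.cross_ne (PP_out t).1 (pos_ne t.2).1.symm (PP_y t)

theorem NN_P (t : T) : NN S t ⬝ᵥ PP S t = 0 := by
  rw [dotProduct_comm]; exact dot_self_cross _ _

theorem NN_x (t : T) : NN S t ⬝ᵥ S.v t.1.1 = 0 := by
  rw [dotProduct_comm]; exact dot_cross_self _ _

theorem NN_D (t : T) : ∃ d ∈ S.D, NN S t ⬝ᵥ d = 0 :=
  CD.meets (PP_out t).1 (pos_ne t.2).1 (pos_ne t.2).2.1 (pos_ne t.2).2.2 (PP_y t) (PP_z t)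

variable (S) in
def pre (t : T) : {w : Vec // w ≠ 0} × {w : Vec // w ≠ 0} :=
  (⟨PP S t, (PP_out t).1⟩, ⟨NN S t, NN_ne t⟩)

theorem PP_cont : Continuous (PP S) := by
  refine cont_cross.comp (Continuous.prodMk ?_ ?_) <;> refine S.hφ.comp ?_ <;> fun_prop

theorem NN_cont : Continuous (NN S) := by
  refine cont_cross.comp (PP_cont.prodMk (S.hv.comp ?_)); fun_prop

theorem pre_cont : Continuous (pre S) :=
  (PP_cont.subtype_mk _).prodMk (NN_cont.subtype_mk _)

def Phi (hR : Rep S C) (t : T) : ↥(Omega2 C) :=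
  ⟨qq (pre S t), (mem_Omega hR _).2 ⟨NN_P t, PP_out t, NN_D t⟩⟩

theorem Phi_cont (hR : Rep S C) : Continuous (Phi hR) :=
  (qq_cont.comp pre_cont).subtype_mk _

theorem key (hR : Rep S C) (t : T) (b : Omega2 C) (a : {w : Vec // w ≠ 0} × {w : Vec // w ≠ 0})
    (hab : qq a = b) : Phi hR t = b ↔
      S.φ t.1.2.1 ⬝ᵥ a.1.1 = 0 ∧ S.φ t.1.2.2 ⬝ᵥ a.1.1 = 0 ∧ a.2.1 ⬝ᵥ S.v t.1.1 = 0 := by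
  have hO := (mem_Omega hR a).1 (hab ▸ b.2)
  rw [Subtype.ext_iff, ← hab]
  constructor
  · intro h
    have h1 : ∃ s : ℝ, s • PP S t = a.1.1 :=
      (Projectivization.mk_eq_mk_iff' ℝ _ _ a.1.2 (PP_out t).1).1 (congrArg Prod.fst h).symm
    have h2 : ∃ s : ℝ, s • NN S t = a.2.1 := q2_eq.1 (congrArg Prod.snd h).symm
    obtain ⟨s, hs⟩ := h1
    obtain ⟨r, hr⟩ := h2
    rw [← hs, ← hr, dotProduct_smul, dotProduct_smul, smul_dotProduct, PP_y, PP_z, NN_x]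
    simp
  · rintro ⟨h1, h2, h3⟩
    obtain ⟨s, hs⟩ := parallel_cross (PP_out (S := S) t).1 (by rwa [dotProduct_comm] at h1)
      (by rwa [dotProduct_comm] at h2)
    have hne : a.1.1 ⨯₃ S.v t.1.1 ≠ 0 := CD.cross_ne a.1.2 (pos_ne t.2).1.symm h1
    obtain ⟨r, hr⟩ := parallel_cross hne hO.1 h3
    refine Prod.ext ?_ ?_
    · exact ((Projectivization.mk_eq_mk_iff' ℝ _ _ a.1.2 (PP_out t).1).2 ⟨s, hs.symm⟩).symm
    · refine (q2_eq.2 ⟨r * s, ?_⟩).symm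
      show (r * s) • (PP S t ⨯₃ S.v t.1.1) = a.2.1
      rw [hr, hs, LinearMap.map_smul, LinearMap.smul_apply, smul_smul]
      rfl

theorem Phi_card (hR : Rep S C) (b : Omega2 C) : (Phi hR ⁻¹' {b}).ncard = 2 := by
  obtain ⟨a, hab⟩ := qq_surj b.1
  obtain ⟨hO1, hO2, c, hc, hc0⟩ := (mem_Omega hR a).1 (hab ▸ b.2)
  obtain ⟨y, z, hyz, hw⟩ := CD.two_tan hO2
  obtain ⟨x1, x2, hx, hxw⟩ := CD.two_pts hO2 a.2.2 hO1 hc hc0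
  have hy := (hw y).2 (Or.inl rfl)
  have hz := (hw z).2 (Or.inr rfl)
  have aux : ∀ x, a.2.1 ⬝ᵥ S.v x = 0 → ∃ t : T, t.1.1 = x ∧ Phi hR t = b ∧
      ∀ t' : T, t'.1.1 = x → Phi hR t' = b → t' = t := by
    intro x hx
    have hxy : x ≠ y := by
      rintro rfl; exact CD.off_tan hO2 hO1 a.2.2 hc hc0 hy hx
    have hxz : x ≠ z := by
      rintro rfl; exact CD.off_tan hO2 hO1 a.2.2 hc hc0 hz hx
    rcases pos_total hxy hxz hyz with h | h
    · refine ⟨⟨(x, y, z), h⟩, rfl, (key hR _ b a hab).2 ⟨hy, hz, hx⟩, ?_⟩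
      rintro ⟨⟨x', y', z'⟩, h'⟩ (rfl : x' = x) ht
      obtain ⟨k1, k2, -⟩ := (key hR _ b a hab).1 ht
      have hne := (pos_ne h').2.2
      rcases (hw _).1 k1 with r1 | r1 <;> rcases (hw _).1 k2 with r2 | r2 <;>
        dsimp only at r1 r2 h' hne <;> subst r1 <;> subst r2
      · exact absurd rfl hne
      · rfl
      · exact (pos_asymm h h').elim
      · exact absurd rfl hne
    · refine ⟨⟨(x, z, y), h⟩, rfl, (key hR _ b a hab).2 ⟨hz, hy, hx⟩, ?_⟩
      rintro ⟨⟨x', y', z'⟩, h'⟩ (rfl : x' = x) ht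
      obtain ⟨k1, k2, -⟩ := (key hR _ b a hab).1 ht
      have hne := (pos_ne h').2.2
      rcases (hw _).1 k1 with r1 | r1 <;> rcases (hw _).1 k2 with r2 | r2 <;>
        dsimp only at r1 r2 h' hne <;> subst r1 <;> subst r2
      · exact absurd rfl hne
      · exact (pos_asymm h h').elim
      · rfl
      · exact absurd rfl hne
  obtain ⟨t1, e1, f1, g1⟩ := aux x1 ((hxw x1).2 (Or.inl rfl))
  obtain ⟨t2, e2, f2, g2⟩ := aux x2 ((hxw x2).2 (Or.inr rfl))
  have hset : Phi hR ⁻¹' {b} = {t1, t2} := by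
    ext t
    simp only [Set.mem_preimage, Set.mem_singleton_iff, Set.mem_insert_iff]
    constructor
    · intro ht
      rcases (hxw _).1 ((key hR t b a hab).1 ht).2.2 with h | h
      · exact Or.inl (g1 t h ht)
      · exact Or.inr (g2 t h ht)
    · rintro (rfl | rfl)
      · exact f1
      · exact f2
  rw [hset, Set.ncard_pair]
  rintro rfl
  exact hx (e1.symm.trans e2)

theorem perturb_v {ψ₀ : Vec} (hψ : ψ₀ ≠ 0) {x₀ : Circle} (hx : ψ₀ ⬝ᵥ S.v x₀ = 0)
    (hD : ∃ d ∈ S.D, ψ₀ ⬝ᵥ d = 0) (U : Set Circle) (hU : U ∈ 𝓝 x₀) :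
    ∀ᶠ ψ in 𝓝 ψ₀, ∃ x ∈ U, ψ ⬝ᵥ S.v x = 0 := by
  obtain ⟨d, hd, hd0⟩ := hD
  refine perturb (fun ψ x => ψ ⬝ᵥ S.v x) (fun p => CD.contvdot p)
    (fun x => cont_dot.comp (continuous_id.prodMk continuous_const)) ψ₀ x₀ ?_ ?_ U hU
  · intro U hU
    obtain ⟨x, hx, h⟩ := CD.signA (S := S) (neg_ne_zero.2 hψ) (by simp [hx]) hd (by simp [hd0]) U hU
    exact ⟨x, hx, by simpa using h⟩
  · exact CD.signA hψ hx hd hd0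

theorem perturb_φ {p₀ : Vec} {y₀ : Circle} (hy : S.φ y₀ ⬝ᵥ p₀ = 0)
    (hc : S.v y₀ ⨯₃ p₀ ≠ 0) (U : Set Circle) (hU : U ∈ 𝓝 y₀) :
    ∀ᶠ p in 𝓝 p₀, ∃ y ∈ U, S.φ y ⬝ᵥ p = 0 := by
  refine perturb (fun p y => S.φ y ⬝ᵥ p) (fun p => CD.contφdot p)
    (fun x => cont_dot.comp (continuous_const.prodMk continuous_id)) p₀ y₀ ?_ ?_ U hU
  · exact CD.signB hy hc
  · intro U hU
    obtain ⟨x, hx, h⟩ := CD.signB (S := S) (p := -p₀) (y₀ := y₀) (by simp [hy])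
      (by rw [map_neg, neg_ne_zero]; exact hc) U hU
    exact ⟨x, hx, by simpa using h⟩

theorem Phi_inj (hR : Rep S C) (t₀ : T) : ∃ U ∈ 𝓝 t₀, Set.InjOn (Phi hR) U := by
  obtain ⟨d, hd, hd0⟩ := NN_D (S := S) t₀
  obtain ⟨x₁, hx1, hx1'⟩ : ∃ x₁, x₁ ≠ t₀.1.1 ∧ NN S t₀ ⬝ᵥ S.v x₁ = 0 := by
    obtain ⟨a, b, hab, hw⟩ := CD.two_pts (PP_out t₀) (NN_ne t₀) (NN_P t₀) hd hd0
    rcases (hw _).1 (NN_x t₀) with h | h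
    · exact ⟨b, by rw [h]; exact hab.symm, (hw b).2 (Or.inr rfl)⟩
    · exact ⟨a, by rw [h]; exact hab, (hw a).2 (Or.inl rfl)⟩
  obtain ⟨U1, U0, hU1, hU0, hm1, hm0, hU⟩ := t2_separation hx1
  obtain ⟨V, W, hV, hW, hmV, hmW, hVW⟩ := t2_separation (pos_ne t₀.2).2.2
  have c1 : Continuous fun t : T => t.1.1 := by fun_prop
  have c2 : Continuous fun t : T => t.1.2.1 := by fun_prop
  have c3 : Continuous fun t : T => t.1.2.2 := by fun_prop
  have e1 := c1.continuousAt.eventually (hU0.mem_nhds hm0)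
  have e2 := c2.continuousAt.eventually (hV.mem_nhds hmV)
  have e3 := c3.continuousAt.eventually (hW.mem_nhds hmW)
  have e4 := (NN_cont (S := S)).continuousAt.eventually
    (perturb_v (NN_ne t₀) hx1' ⟨d, hd, hd0⟩ U1 (hU1.mem_nhds hm1))
  refine ⟨_, e1.and (e2.and (e3.and e4)), ?_⟩
  rintro t ⟨a1, a2, a3, x', hx', hx'0⟩ t' ⟨b1, b2, b3, -⟩ htt
  obtain ⟨k1, k2, k3⟩ := (key hR t' (Phi hR t) (pre S t) rfl).1 htt.symm
  have ny : t'.1.2.1 ≠ t.1.2.2 := fun h => Set.disjoint_left.1 hVW b2 (h ▸ a3)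
  have nz : t'.1.2.2 ≠ t.1.2.1 := fun h => Set.disjoint_left.1 hVW a2 (h ▸ b3)
  have hyz := (pos_ne t.2).2.2
  have ey : t'.1.2.1 = t.1.2.1 := by
    by_contra h
    exact CD.three_tan (PP_out t).1 k1 (PP_y t) (PP_z t) h ny hyz
  have ez : t'.1.2.2 = t.1.2.2 := by
    by_contra h
    exact CD.three_tan (PP_out t).1 k2 (PP_y t) (PP_z t) nz h hyz
  have ex : t'.1.1 = t.1.1 := by
    by_contra h
    refine S.three (NN S t) (NN_ne t) _ _ x' k3 (NN_x t) hx'0 h ?_ ?_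
    · rintro rfl; exact Set.disjoint_left.1 hU hx' b1
    · rintro rfl; exact Set.disjoint_left.1 hU hx' a1
  exact (Subtype.ext (Prod.ext ex (Prod.ext ey ez))).symm

theorem Phi_open (hR : Rep S C) : IsOpenMap (Phi hR) := by
  rw [isOpenMap_iff_nhds_le]
  intro t₀ N hN
  rw [mem_map, nhds_subtype_eq_comap] at hN
  obtain ⟨M, hM, hMN⟩ := hN
  have hM' := inter_mem hM (pos_open.mem_nhds t₀.2)
  obtain ⟨Ux, hUx, Uyz, hUyz, hs⟩ := mem_nhds_prod_iff.1 hM'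
  obtain ⟨Uy, hUy, Uz, hUz, hs'⟩ := mem_nhds_prod_iff.1 hUyz
  have hne := (pos_ne t₀.2).2.2
  have e1 := perturb_v (S := S) (NN_ne t₀) (NN_x t₀) (NN_D t₀) Ux hUx
  have e2 := perturb_φ (S := S) (PP_y t₀) (CD.cross_ne' (PP_out t₀).1 hne.symm (PP_z t₀)) Uy hUy
  have e3 := perturb_φ (S := S) (PP_z t₀) (CD.cross_ne' (PP_out t₀).1 hne (PP_y t₀)) Uz hUz
  have E : ∀ᶠ a in 𝓝 (pre S t₀), (∃ x ∈ Ux, a.2.1 ⬝ᵥ S.v x = 0) ∧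
      (∃ y ∈ Uy, S.φ y ⬝ᵥ a.1.1 = 0) ∧ (∃ z ∈ Uz, S.φ z ⬝ᵥ a.1.1 = 0) := by
    have c1 : ContinuousAt (fun a : {w : Vec // w ≠ 0} × {w : Vec // w ≠ 0} => a.1.1) (pre S t₀) :=
      Continuous.continuousAt (by fun_prop)
    have c2 : ContinuousAt (fun a : {w : Vec // w ≠ 0} × {w : Vec // w ≠ 0} => a.2.1) (pre S t₀) :=
      Continuous.continuousAt (by fun_prop)
    exact (c2.eventually e1).and ((c1.eventually e2).and (c1.eventually e3))
  have E2 : ∀ᶠ b in 𝓝 (qq (pre S t₀)), ∃ a, qq a = b ∧ (∃ x ∈ Ux, a.2.1 ⬝ᵥ S.v x = 0) ∧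
      (∃ y ∈ Uy, S.φ y ⬝ᵥ a.1.1 = 0) ∧ (∃ z ∈ Uz, S.φ z ⬝ᵥ a.1.1 = 0) := by
    refine qq_open.nhds_le _ ?_
    rw [mem_map]
    filter_upwards [E] with a ha
    exact ⟨a, rfl, ha⟩
  have E3 : ∀ᶠ b in 𝓝 (Phi hR t₀), ∃ a, qq a = b.1 ∧ (∃ x ∈ Ux, a.2.1 ⬝ᵥ S.v x = 0) ∧
      (∃ y ∈ Uy, S.φ y ⬝ᵥ a.1.1 = 0) ∧ (∃ z ∈ Uz, S.φ z ⬝ᵥ a.1.1 = 0) :=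
    (continuous_subtype_val.continuousAt (x := Phi hR t₀)).eventually E2
  filter_upwards [E3] with b hb
  obtain ⟨a, hab, ⟨x, hx, hx0⟩, ⟨y, hy, hy0⟩, ⟨z, hz, hz0⟩⟩ := hb
  have hm := hs (Set.mk_mem_prod hx (hs' (Set.mk_mem_prod hy hz)))
  have : Phi hR ⟨(x, y, z), hm.2⟩ = b := (key hR _ b a hab).2 ⟨hy0, hz0, hx0⟩
  rw [← this]
  exact hMN hm.1

end Aux4

theorem statement_11
    (C : Set (ℙ ℝ (Fin 3 → ℝ))) (hCopen : IsOpen C) (hCpc : ProperlyConvex C)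
    (hstrict : StrictlyConvexBoundary C)
    (hC1 : ∀ p ∈ frontier C, ∃! W : Submodule ℝ (Fin 3 → ℝ), IsSupportingLineAt C W p)
    (ξ₁ : Circle → ℙ ℝ (Fin 3 → ℝ))
    (hξ₁ : ∃ e : Circle ≃ₜ frontier C, ∀ x, (e x : ℙ ℝ (Fin 3 → ℝ)) = ξ₁ x)
    (ξ₂ : Circle → Submodule ℝ (Fin 3 → ℝ))
    (hξ₂ : ∀ x, IsSupportingLineAt C (ξ₂ x) (ξ₁ x)) :
    ∃ Φ : {t : Circle × Circle × Circle // PosOriented t.1 t.2.1 t.2.2} → ↥(Omega2 C),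
      (∀ t, (Φ t : ℙ ℝ (Fin 3 → ℝ) × ℙ ℝ (Module.Dual ℝ (Fin 3 → ℝ))).1.submodule =
          ξ₂ t.1.2.1 ⊓ ξ₂ t.1.2.2) ∧
      (∀ t, (Φ t : ℙ ℝ (Fin 3 → ℝ) × ℙ ℝ (Module.Dual ℝ (Fin 3 → ℝ))).2.submodule =
          ((ξ₂ t.1.2.1 ⊓ ξ₂ t.1.2.2) ⊔ (ξ₁ t.1.1).submodule).dualAnnihilator) ∧
      Function.Surjective Φ ∧
      IsCoveringMap Φ ∧
      (∀ b, (Φ ⁻¹' {b}).ncard = 2) := by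
  obtain ⟨S, h1, h2, h3, h4⟩ := build C hCopen hCpc hstrict hC1 ξ₁ hξ₁ ξ₂ hξ₂
  have hR : Rep S C := ⟨h3, h4⟩
  have hs : ∀ t : T, Submodule.span ℝ {PP S t} = ξ₂ t.1.2.1 ⊓ ξ₂ t.1.2.2 := by
    intro t
    ext u
    rw [Submodule.mem_span_singleton, Submodule.mem_inf, h2, h2]
    constructor
    · rintro ⟨a, rfl⟩
      rw [dotProduct_smul, dotProduct_smul, PP_y, PP_z]; simp
    · rintro ⟨k1, k2⟩
      obtain ⟨s, hs⟩ := parallel_cross (PP_out (S := S) t).1 (by rwa [dotProduct_comm] at k1)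
        (by rwa [dotProduct_comm] at k2)
      exact ⟨s, hs.symm⟩
  refine ⟨Phi hR, ?_, ?_, ?_, ?_, Phi_card hR⟩
  · intro t
    rw [← hs]
    exact Projectivization.submodule_mk _ _
  · intro t
    rw [← hs, h1]
    refine (q2_sub _).trans ?_
    ext g
    obtain ⟨w, rfl⟩ := (dotProductEquiv ℝ (Fin 3)).surjective g
    rw [← Submodule.span_union, Submodule.mem_span_singleton, Submodule.mem_dualAnnihilator]
    constructor
    · rintro ⟨r, hr⟩
      rw [← map_smul, EmbeddingLike.apply_eq_iff_eq] at hr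
      have hr' : r • NN S t = w := hr
      intro u hu
      have hle : Submodule.span ℝ ({PP S t} ∪ {S.v t.1.1}) ≤
          LinearMap.ker (dotProductEquiv ℝ (Fin 3) w) := by
        rw [Submodule.span_le]
        rintro _ (rfl | rfl)
        · simp [← hr', NN_P]
        · simp [← hr', NN_x]
      exact hle hu
    · intro h
      have k1 := h _ (Submodule.subset_span (Or.inl rfl))
      have k2 := h _ (Submodule.subset_span (Or.inr rfl))
      obtain ⟨r, hr⟩ := parallel_cross (NN_ne (S := S) t) k1 k2
      refine ⟨r, ?_⟩
      rw [← map_smul]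
      exact congrArg _ hr.symm
  · intro b
    have := Phi_card hR b
    have hne : (Phi hR ⁻¹' {b}).Nonempty := by
      rw [← Set.ncard_pos (Set.finite_of_ncard_ne_zero (by omega))]; omega
    obtain ⟨t, ht⟩ := hne
    exact ⟨t, ht⟩
  · exact cover_aux _ (Phi_cont hR) (Phi_open hR) (Phi_inj hR) (Phi_card hR)

end CFF
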